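/- For every integer n ≥ 2, the number 9^n - 8^n is not a perfect power: there are no integers m ≥ 2 and k ≥ 2 with 9^n - 8^n = m^k. -/

import Mathlib

theorem jacobiSym_natAbs_comm {A : ℤ} (hA : A % 4 = 1) {r : ℕ} (hr : Odd r) :
    jacobiSym r A.natAbs = jacobiSym A r := by
  rcases le_total 0 A with h | h
  · lift A to ℕ using h
    rw [Int.natAbs_natCast]
    exact (jacobiSym.quadratic_reciprocity_one_mod_four (by omega) hr).symm
  · obtain ⟨a, rfl⟩ : ∃ a : ℕ, A = -a := ⟨A.natAbs, by omega⟩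
    rw [Int.natAbs_neg, Int.natAbs_natCast, neg_eq_neg_one_mul, jacobiSym.mul_left,
      jacobiSym.at_neg_one hr]
    have ha : a % 4 = 3 := by omega
    rcases Nat.odd_mod_four_iff.mp (Nat.odd_iff.mp hr) with h1 | h3
    · rw [ZMod.χ₄_nat_one_mod_four h1, one_mul]
      exact jacobiSym.quadratic_reciprocity_one_mod_four h1 (Nat.odd_iff.mpr (by omega))
    · rw [ZMod.χ₄_nat_three_mod_four h3, jacobiSym.quadratic_reciprocity_three_mod_four h3 ha]
      ring

theorem jacobiSym_two_pow_natAbs {A : ℤ} (hA : A % 8 = 1) (k : ℕ) :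
    jacobiSym (2 ^ k) A.natAbs = 1 := by
  have hodd : Odd A.natAbs := Nat.odd_iff.mpr (by omega)
  rw [jacobiSym.pow_left, jacobiSym.at_two hodd, ZMod.χ₈_nat_eq_if_mod_eight]
  have : A.natAbs % 8 = 1 ∨ A.natAbs % 8 = 7 := by omega
  rw [if_neg (by omega), if_pos this, one_pow]

theorem jacobiSym_neg_one_natAbs {A : ℤ} (hA : A % 8 = 1) (hpos : 0 < A) :
    jacobiSym (-1) A.natAbs = 1 := by
  rw [jacobiSym.at_neg_one (Nat.odd_iff.mpr (by omega)), ZMod.χ₄_nat_one_mod_four (by omega)]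

/-- The symbol `(ρ / |A|)` with `A ≡ 1 [ZMOD 8]` depends only on `A` modulo the odd part of `ρ`. -/
theorem jacobiSym_natAbs_congr {A B ρ : ℤ} {j : ℕ} (hA : A % 8 = 1) (hB : B % 8 = 1)
    (h : ρ ∣ 2 ^ j * (A - B)) (hs : 0 < ρ ∨ 0 < A ∧ 0 < B) :
    jacobiSym ρ A.natAbs = jacobiSym ρ B.natAbs := by
  rcases eq_or_ne ρ 0 with rfl | hρ
  · have : A = B := by
      rw [zero_dvd_iff, mul_eq_zero] at h
      rcases h with h | h
      · exact absurd h (by positivity)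
      · linarith
    rw [this]
  · obtain ⟨k, r, hr, hkr⟩ := Nat.exists_eq_two_pow_mul_odd (Int.natAbs_ne_zero.mpr hρ)
    have hdvd : (r : ℤ) ∣ A - B := by
      have h1 : (r : ℤ) ∣ 2 ^ j * (A - B) :=
        (Int.natCast_dvd.mpr (Dvd.intro_left (2 ^ k) hkr.symm)).trans h
      refine IsCoprime.dvd_of_dvd_mul_left ?_ h1
      have : IsCoprime ((r : ℕ) : ℤ) ((2 ^ j : ℕ) : ℤ) :=
        Nat.isCoprime_iff_coprime.mpr ((Nat.coprime_two_right.mpr hr).pow_right j)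
      exact_mod_cast this
    have key : jacobiSym r A.natAbs = jacobiSym r B.natAbs := by
      rw [jacobiSym_natAbs_comm (by omega) hr, jacobiSym_natAbs_comm (by omega) hr]
      exact jacobiSym.mod_left' (Int.emod_eq_emod_iff_emod_sub_eq_zero.mpr
        (Int.emod_eq_zero_of_dvd hdvd))
    have pos : ∀ C : ℤ, C % 8 = 1 → jacobiSym (2 ^ k * r : ℤ) C.natAbs = jacobiSym r C.natAbs := by
      intro C hC
      rw [jacobiSym.mul_left, jacobiSym_two_pow_natAbs hC, one_mul]
    rcases lt_or_gt_of_ne hρ with hneg | hpos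
    · have e : ρ = -1 * (2 ^ k * r : ℤ) := by
        have : ((ρ.natAbs : ℕ) : ℤ) = 2 ^ k * r := by rw [hkr]; push_cast; ring
        omega
      rcases hs with hs | ⟨h1, h2⟩
      · omega
      rw [e, jacobiSym.mul_left, jacobiSym.mul_left (-1), jacobiSym_neg_one_natAbs hA h1,
        jacobiSym_neg_one_natAbs hB h2, pos A hA, pos B hB, key]
    · have e : ρ = (2 ^ k * r : ℤ) := by
        have : ((ρ.natAbs : ℕ) : ℤ) = 2 ^ k * r := by rw [hkr]; push_cast; ring
        omega
      rw [e, pos A hA, pos B hB, key]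

theorem pow_sub_mul_two_pow_emod_eight {m σ : ℤ} (hm : m % 8 = 1) (x : ℕ) {b : ℕ} (hb : 3 ≤ b) :
    (m ^ x - σ * 2 ^ b) % 8 = 1 := by
  obtain ⟨c, rfl⟩ := Nat.exists_eq_add_of_le hb
  have h : m ^ x ≡ 1 ^ x [ZMOD 8] := Int.ModEq.pow x hm
  have h2 : σ * 2 ^ (3 + c) ≡ 0 [ZMOD 8] :=
    Int.modEq_zero_iff_dvd.mpr ⟨σ * 2 ^ c, by rw [pow_add]; ring⟩
  have h3 := h.sub h2
  rw [one_pow, sub_zero] at h3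
  exact h3

set_option maxHeartbeats 1000000 in
theorem jacobiSym_ne_neg_one_of_descent {m p s j : ℕ} {c : ℤ} (hm : m % 8 = 1) (hm1 : 1 < m)
    (hs : 2 * p + 1 ≤ s) (hps : Nat.Coprime p s) (hsq : (m : ℤ) ^ p + 2 ^ s = c ^ 2)
    (N : ℕ) :
    ∀ (α β x b x' u : ℕ) (σ σ' : ℤ), α + β = N → 1 ≤ α → 1 ≤ x →
      (σ = 1 ∨ σ = -1) → (σ' = 1 ∨ σ' = -1) → ¬ (σ = 1 ∧ σ' = 1) → σ ^ α * σ' ^ β = -1 →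
      α * x + β * x' = p → α * b + β * u = s + β * j → u * x < b * x' + j * x →
      jacobiSym (2 ^ j * m ^ x' - σ' * 2 ^ u) ((m : ℤ) ^ x - σ * 2 ^ b).natAbs ≠ -1 := by
  have hmz : (m : ℤ) % 8 = 1 := by omega
  have hb3 : ∀ α β x b x' u : ℕ, α * x + β * x' = p → α * b + β * u = s + β * j → 1 ≤ x →
      u * x < b * x' + j * x → 3 ≤ b := by
    intro α β x b x' u h1 h2 hx hD
    have key : s * x ≤ b * p := by
      have e : (b * p : ℤ) = s * x + β * (b * x' + j * x - u * x) := by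
        have h1' : (α * x + β * x' : ℤ) = p := by exact_mod_cast h1
        have h2' : (α * b + β * u : ℤ) = s + β * j := by exact_mod_cast h2
        rw [← h1']
        linear_combination (x : ℤ) * h2'
      have hD' : (u * x : ℤ) < b * x' + j * x := by exact_mod_cast hD
      have : (0 : ℤ) ≤ β * (b * x' + j * x - u * x) := mul_nonneg (by positivity) (by linarith)
      have : (s * x : ℤ) ≤ b * p := by linarith
      exact_mod_cast this
    by_contra! hlt
    have : b * p ≤ 2 * p := Nat.mul_le_mul_right _ (by omega)
    have : s * 1 ≤ s * x := Nat.mul_le_mul_left _ hx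
    omega
  induction N using Nat.strong_induction_on with
  | _ N ih =>
  intro α β x b x' u σ σ' hN hα hx hσ hσ' hσσ hsign hp hb hD
  have hb' := hb3 α β x b x' u hp hb hx hD
  have hL8 := pow_sub_mul_two_pow_emod_eight (σ := σ) hmz x hb'
  have hLpos : σ = -1 → 0 < (m : ℤ) ^ x - σ * 2 ^ b := by
    rintro rfl
    rw [neg_one_mul, sub_neg_eq_add]
    positivity
  rcases Nat.eq_zero_or_pos β with rfl | hβ
  · have hα1 : α = 1 := Nat.eq_one_of_dvd_coprimes hps ⟨x, by omega⟩ ⟨b, by omega⟩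
    subst hα1
    have e1 : x = p := by omega
    have e2 : b = s := by omega
    have e3 : σ = -1 := by simpa using hsign
    subst e1 e2 e3
    rw [show (m : ℤ) ^ x - -1 * 2 ^ b = c ^ 2 by rw [← hsq]; ring, Int.natAbs_pow,
      jacobiSym.pow_right]
    intro h
    linarith [sq_nonneg (jacobiSym (2 ^ j * (m : ℤ) ^ x' - σ' * 2 ^ u) c.natAbs)]
  rcases lt_or_ge β α with hlt | hge
  · have := ih (α - β + β) (by omega) (α - β) β x b (x + x') (u + b) σ (σ * σ') rfl (by omega) hx hσ
      (by rcases hσ with rfl | rfl <;> rcases hσ' with rfl | rfl <;> simp)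
      (by rcases hσ with rfl | rfl <;> rcases hσ' with rfl | rfl <;> simp_all)
      (by rw [mul_pow, ← mul_assoc, ← pow_add, Nat.sub_add_cancel hlt.le, hsign])
      (by
        rw [← hp, Nat.sub_mul, Nat.mul_add, ← Nat.add_assoc,
          Nat.sub_add_cancel (Nat.mul_le_mul_right _ hlt.le)])
      (by
        rw [← hb, Nat.sub_mul, Nat.mul_add, Nat.add_comm (β * u), ← Nat.add_assoc,
          Nat.sub_add_cancel (Nat.mul_le_mul_right _ hlt.le)])
      (by nlinarith)
    convert this using 1
    have e : (2 ^ j * (m : ℤ) ^ (x + x') - σ * σ' * 2 ^ (u + b)) =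
        σ * 2 ^ b * (2 ^ j * (m : ℤ) ^ x' - σ' * 2 ^ u) +
          ((m : ℤ) ^ x - σ * 2 ^ b) * (2 ^ j * (m : ℤ) ^ x') := by ring
    have e2 : jacobiSym (2 ^ j * (m : ℤ) ^ (x + x') - σ * σ' * 2 ^ (u + b))
        ((m : ℤ) ^ x - σ * 2 ^ b).natAbs =
        jacobiSym (σ * 2 ^ b * (2 ^ j * (m : ℤ) ^ x' - σ' * 2 ^ u))
          ((m : ℤ) ^ x - σ * 2 ^ b).natAbs := by
      apply jacobiSym.mod_left'
      rw [e]
      apply Int.emod_eq_emod_iff_emod_sub_eq_zero.mpr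
      apply Int.emod_eq_zero_of_dvd
      rw [add_sub_cancel_left]
      exact (Int.natAbs_dvd.mpr dvd_rfl).mul_right _
    rw [e2, jacobiSym.mul_left, jacobiSym.mul_left, jacobiSym_two_pow_natAbs hL8, mul_one]
    rcases hσ with rfl | rfl
    · rw [jacobiSym.one_left, one_mul, one_mul]
    · rw [jacobiSym_neg_one_natAbs hL8 (hLpos rfl), one_mul]
  · have hD' : (u * x : ℤ) < b * x' + j * x := by exact_mod_cast hD
    have hxx : 0 < x + x' := by omega
    obtain ⟨v, hv⟩ : ∃ v : ℕ, v + j = b + u := by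
      refine ⟨b + u - j, Nat.sub_add_cancel ?_⟩
      by_contra! hlt
      have h1 : α * (b + u) + (β - α) * u = s + (β - α) * j + α * j := by
        have : β = (β - α) + α := by omega
        generalize β - α = γ at *
        subst this
        linarith
      have h2 : u ≤ j := by omega
      have h3 : (β - α) * u ≤ (β - α) * j := Nat.mul_le_mul_left _ h2
      have h4 : α * (x + x') + (β - α) * x' = p := by
        have : β = (β - α) + α := by omega
        generalize β - α = γ at *
        subst this
        linarith
      have h5 : (α * ((b : ℤ) + u - j) + (β - α : ℕ) * (u - j)) = s := by
        have : (α * (b + u) + (β - α : ℕ) * u : ℤ) = s + (β - α : ℕ) * j + α * j := by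
          exact_mod_cast h1
        linarith
      have h6 : ((b : ℤ) + u - j) < 0 := by
        have : ((b + u : ℕ) : ℤ) < j := by exact_mod_cast hlt
        push_cast at this
        linarith
      have h7 : (0 : ℤ) ≤ s := by positivity
      have h8 : (α : ℤ) * ((b : ℤ) + u - j) < 0 :=
        mul_neg_of_pos_of_neg (by exact_mod_cast hα) h6
      have h9 : ((β - α : ℕ) : ℤ) * (u - j) ≤ 0 :=
        mul_nonpos_of_nonneg_of_nonpos (by positivity) (by
          have : (u : ℤ) ≤ j := by exact_mod_cast h2
          linarith)
      linarith
    have hb2 : α * v + (β - α) * u = s + (β - α) * j := by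
      have : β = (β - α) + α := by omega
      generalize β - α = γ at *
      subst this
      have : α * (v + j) = α * (b + u) := by rw [hv]
      linarith
    have hp2 : α * (x + x') + (β - α) * x' = p := by
      have : β = (β - α) + α := by omega
      generalize β - α = γ at *
      subst this
      linarith
    have hD2 : u * (x + x') < v * x' + j * (x + x') := by
      have : (v + j) * x' = (b + u) * x' := by rw [hv]
      linarith
    have hsgn : (σ * σ' = 1 ∨ σ * σ' = -1) := by
      rcases hσ with rfl | rfl <;> rcases hσ' with rfl | rfl <;> simp
    have hnot : ¬ (σ * σ' = 1 ∧ σ' = 1) := by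
      rcases hσ with rfl | rfl <;> rcases hσ' with rfl | rfl <;> simp_all
    have := ih (α + (β - α)) (by omega) α (β - α) (x + x') v x' u (σ * σ') σ' rfl hα hxx
      hsgn hσ' hnot
      (by rw [mul_pow, mul_assoc, ← pow_add, Nat.add_sub_cancel' hge, hsign]) hp2 hb2 hD2
    convert this using 1
    have hb3' := hb3 _ _ _ _ _ _ hp2 hb2 hxx hD2
    have hL8' := pow_sub_mul_two_pow_emod_eight (σ := σ * σ') hmz (x + x') hb3'
    have hmx : ((m : ℤ) ^ x') % 8 = 1 := by
      simpa using pow_sub_mul_two_pow_emod_eight (σ := 0) hmz x' le_rfl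
    have hB : ((m : ℤ) ^ x' * ((m : ℤ) ^ x - σ * 2 ^ b)) % 8 = 1 := by
      rw [Int.mul_emod, hmx, hL8]; rfl
    have key := jacobiSym_natAbs_congr (ρ := 2 ^ j * (m : ℤ) ^ x' - σ' * 2 ^ u) (j := j) hL8' hB
      ⟨σ * 2 ^ b, by
        have : (2 : ℤ) ^ j * 2 ^ v = 2 ^ b * 2 ^ u := by
          rw [← pow_add, ← pow_add, ← hv]
          ring
        linear_combination (-σ * σ') * this⟩
      (by
        rcases hσ' with rfl | rfl
        · right
          have : σ = -1 := by tauto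
          subst this
          refine ⟨?_, mul_pos (by positivity) (hLpos rfl)⟩
          rw [mul_one, neg_one_mul, sub_neg_eq_add]
          positivity
        · left
          rw [neg_one_mul, sub_neg_eq_add]
          positivity)
    rw [key, Int.natAbs_mul]
    have hm0 : ((m : ℤ) ^ x').natAbs ≠ 0 := by positivity
    have : NeZero ((m : ℤ) ^ x').natAbs := ⟨hm0⟩
    have : NeZero ((m : ℤ) ^ x - σ * 2 ^ b).natAbs := ⟨by omega⟩
    rw [jacobiSym.mul_right]
    have : jacobiSym (2 ^ j * (m : ℤ) ^ x' - σ' * 2 ^ u) ((m : ℤ) ^ x').natAbs = 1 := by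
      rcases Nat.eq_zero_or_pos x' with rfl | hx'
      · simp
      rw [Int.natAbs_pow, jacobiSym.pow_right]
      have h2 : jacobiSym (2 ^ u) (m : ℤ).natAbs = 1 := jacobiSym_two_pow_natAbs hmz u
      have h1 : jacobiSym (2 ^ j * (m : ℤ) ^ x' - σ' * 2 ^ u) (m : ℤ).natAbs =
          jacobiSym (-σ' * 2 ^ u) (m : ℤ).natAbs := by
        apply jacobiSym.mod_left'
        apply Int.emod_eq_emod_iff_emod_sub_eq_zero.mpr
        apply Int.emod_eq_zero_of_dvd
        refine Int.natAbs_dvd.mpr ⟨2 ^ j * (m : ℤ) ^ (x' - 1), ?_⟩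
        obtain ⟨y, rfl⟩ : ∃ y, x' = y + 1 := ⟨x' - 1, by omega⟩
        simp only [Nat.add_sub_cancel]
        ring
      rw [h1, jacobiSym.mul_left, h2, mul_one]
      rcases hσ' with rfl | rfl
      · rw [jacobiSym_neg_one_natAbs hmz (by omega), one_pow]
      · rw [neg_neg, jacobiSym.one_left, one_pow]
    rw [this, one_mul]

/-- Quadratic reciprocity obstruction for `m ^ p + 2 ^ s = c ^ 2`: the symbol of `m + 2 ^ e` modulo
`2 ^ j ∓ 1` is not `-1` when `p e ≡ s` modulo `j`, respectively `2 j`. -/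
theorem jacobiSym_add_two_pow_ne_neg_one {m p s j e N : ℕ} {c σ : ℤ} (hm : m % 8 = 1) (hm1 : 1 < m)
    (hp : Odd p) (hs : 2 * p + 1 ≤ s) (hps : Nat.Coprime p s)
    (hsq : (m : ℤ) ^ p + 2 ^ s = c ^ 2) (hj : 1 ≤ j) (hN : (N : ℤ) = 2 ^ j - σ) {i : ℕ}
    (he : p * e = s + i * j) (hσ : σ = 1 ∨ σ = -1 ∧ Even i) :
    jacobiSym (m + 2 ^ e : ℤ) N ≠ -1 := by
  have hp0 := hp.pos
  have he3 : 3 ≤ e := by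
    by_contra! h
    have : p * e ≤ p * 2 := Nat.mul_le_mul_left _ (by omega)
    nlinarith [Nat.zero_le (i * j)]
  have hd := jacobiSym_ne_neg_one_of_descent (j := j) hm hm1 hs hps hsq (p + i) p i 1 e 0 0 (-1) σ
    rfl hp0 le_rfl
    (Or.inr rfl) (by tauto) (by norm_num)
    (by
      rw [hp.neg_one_pow]
      rcases hσ with rfl | ⟨rfl, hi⟩
      · simp
      · simp [hi.neg_one_pow])
    (by ring) (by linarith) (by omega)
  have e1 : (2 ^ j * (m : ℤ) ^ 0 - σ * 2 ^ 0) = N := by rw [hN]; ring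
  have e2 : ((m : ℤ) ^ 1 - -1 * 2 ^ e) = m + 2 ^ e := by ring
  rw [e1, e2] at hd
  have h8 := pow_sub_mul_two_pow_emod_eight (m := m) (σ := -1) (by omega) 1 he3
  rw [e2] at h8
  have hNodd : Odd N := by
    have h2 : (2 : ℤ) ∣ 2 ^ j := dvd_pow_self 2 (by omega)
    rw [Nat.odd_iff]
    rcases hσ with rfl | ⟨rfl, -⟩ <;> omega
  rwa [jacobiSym_natAbs_comm (by omega) hNodd] at hd

/-- A solution of `m ^ p + 8 ^ n = 9 ^ n` in the range not excluded by factorization. -/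
structure PrimePowerSolution (m p n : ℕ) : Prop where
  prime : p.Prime
  five_le : 5 ≤ p
  coprime : p.Coprime (3 * n)
  odd : Odd n
  lt : p < n
  mod_eight : m % 8 = 1
  one_lt : 1 < m
  eq : m ^ p + 8 ^ n = 9 ^ n

/-- The conjunction of `f 0`, …, `f (k - 1)`. -/
def allLt (f : ℕ → Bool) (k : ℕ) : Bool :=
  Nat.rec true (fun i ih => and (f i) ih) k

theorem allLt_eq_true {f : ℕ → Bool} {k : ℕ} : allLt f k = true ↔ ∀ i < k, f i = true := by
  induction k with
  | zero => simp [allLt]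
  | succ k ih =>
    rw [show allLt f (k + 1) = and (f k) (allLt f k) from rfl, Bool.and_eq_true, ih]
    constructor
    · rintro ⟨h1, h2⟩ i hi
      rcases Nat.lt_succ_iff_lt_or_eq.mp hi with h | rfl
      exacts [h2 i h, h1]
    · exact fun h => ⟨h k (Nat.lt_succ_self k), fun i hi => h i (hi.trans (Nat.lt_succ_self k))⟩

/-- A modulus `2 ^ exponent ∓ 1` with its prime factors, a multiple `order` of the order of `2`, and
an exponent `period` of its unit group. -/
structure ReciprocityModulus where
  exponent : ℕ
  modulus : ℕ
  order : ℕ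
  factors : List ℕ
  period : ℕ
  exponent_pos : 1 ≤ exponent
  modulus_eq : modulus + 1 = 2 ^ exponent ∧ order = exponent ∨
    modulus = 2 ^ exponent + 1 ∧ order = 2 * exponent
  period_pos : 0 < period
  coprime_three : Nat.Coprime 3 modulus
  order_dvd : order ∣ period
  prod_factors : factors.prod = modulus
  prime_factors : ∀ f ∈ factors, f.Prime
  pow_period : allLt (fun a => or (!(Nat.beq (Nat.gcd a modulus) 1))
    (Nat.beq (Nat.mod (Nat.pow a period) modulus) 1)) modulus = true

/-- The tests of the sieve: a quadratic reciprocity symbol, or a power residue modulo a prime. -/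
inductive SieveTest where
  | reciprocity (D : ReciprocityModulus)
  | residue (q : ℕ)

namespace SieveTest

/-- `a ^ r % N`, through powers of moderate size. -/
def powMod (a r N : ℕ) : ℕ :=
  Nat.mod (Nat.mul (Nat.pow (Nat.mod (Nat.pow a (Nat.div r 256)) N) 256)
    (Nat.pow a (Nat.mod r 256))) N

/-- The residue of `9 ^ r - 8 ^ r` modulo `N`. -/
def diffMod (r N : ℕ) : ℕ :=
  Nat.mod (Nat.add (powMod 9 r N) (Nat.sub N (powMod 8 r N))) N

/-- Evaluates the product of the Legendre symbols of `a`, up to the sign `neg`, by Euler's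
criterion, and tests whether it is `1`. -/
def signTest (a : ℕ) : List ℕ → Bool → Bool
  | [], neg => !neg
  | f :: fs, neg =>
    let v := Nat.mod (Nat.pow a (Nat.div f 2)) f
    bif Nat.beq v 0 then false else signTest a fs (bif Nat.beq v 1 then neg else !neg)

/-- The period of the test in the exponent `n`. -/
def period : SieveTest → ℕ
  | reciprocity D => D.period
  | residue q => Nat.sub q 1

set_option exponentiation.threshold 1000 in
/-- Whether the test excludes `m ^ p + 8 ^ n = 9 ^ n`. -/
def excludes (p n : ℕ) : SieveTest → Bool
  | reciprocity ⟨_, N, o, fs, P, _, _, _, _, _, _, _, _⟩ =>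
    let d := Nat.mod (Nat.pow p 959) P
    let x := diffMod (Nat.mod n P) N
    and (Nat.beq (Nat.mod (Nat.mul p d) P) 1) (and (Nat.beq (Nat.gcd x N) 1)
      (signTest (Nat.add (Nat.mod (Nat.pow x d) N)
        (Nat.pow 2 (Nat.mod (Nat.mul (Nat.mul 3 n) d) o))) fs true))
  | residue q =>
    Nat.ble 2 (Nat.mod (Nat.pow (diffMod (Nat.mod n (Nat.sub q 1)) q) (Nat.div (Nat.sub q 1) p)) q)

/-- Whether a residue test has a prime modulus `q ≡ 1 [MOD p]`, for `q` below `582 ^ 2`. -/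
def wellFormed (p : ℕ) : SieveTest → Bool
  | reciprocity _ => true
  | residue q => Nat.blt 1 q && Nat.blt q 338724 && Nat.beq (Nat.mod q p) 1 &&
    allLt (fun d => or (Nat.ble q (d + 2)) (Nat.blt 0 (Nat.mod q (d + 2)))) 580

/-- Whether the tests together exclude all exponents congruent to `n` modulo `M`. -/
def sieve (p : ℕ) : List SieveTest → ℕ → ℕ → Bool
  | [], _, _ => false
  | t :: ts, M, n =>
    let M' := M.lcm t.period
    allLt (fun i =>
      let k := Nat.add n (Nat.mul M i)
      or (t.excludes p k) (sieve p ts M' k)) (Nat.div M' M)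

end SieveTest

open SieveTest

theorem PrimePowerSolution.two_mul_le {m p n : ℕ} (h : PrimePowerSolution m p n) :
    2 * p + 1 ≤ 3 * n := by
  have := h.lt
  omega

theorem PrimePowerSolution.odd_prime {m p n : ℕ} (h : PrimePowerSolution m p n) : Odd p :=
  h.prime.odd_of_ne_two (by have := h.five_le; omega)

theorem PrimePowerSolution.sq {m p n : ℕ} (h : PrimePowerSolution m p n) :
    (m : ℤ) ^ p + 2 ^ (3 * n) = (3 ^ n) ^ 2 := by
  have := h.eq
  rw [pow_mul 2, ← pow_mul 3, mul_comm n, pow_mul 3]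
  norm_num
  exact_mod_cast this

namespace ReciprocityModulus

variable (D : ReciprocityModulus)

theorem modulus_eq_sub : ∃ σ : ℤ, (D.modulus : ℤ) = 2 ^ D.exponent - σ ∧
    (σ = 1 ∧ D.order = D.exponent ∨ σ = -1 ∧ D.order = 2 * D.exponent) := by
  rcases D.modulus_eq with ⟨h, h'⟩ | ⟨h, h'⟩
  · refine ⟨1, ?_, Or.inl ⟨rfl, h'⟩⟩
    rw [eq_sub_iff_add_eq]
    exact_mod_cast h
  · refine ⟨-1, ?_, Or.inr ⟨rfl, h'⟩⟩
    rw [sub_neg_eq_add]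
    exact_mod_cast h

theorem odd_modulus : Odd D.modulus := by
  have h2 : 2 ∣ 2 ^ D.exponent := dvd_pow_self 2 (by have := D.exponent_pos; omega)
  rw [Nat.odd_iff]
  rcases D.modulus_eq with ⟨h, -⟩ | ⟨h, -⟩ <;> omega

theorem two_pow_order_modEq : 2 ^ D.order ≡ 1 [MOD D.modulus] := by
  rcases D.modulus_eq with ⟨h, h'⟩ | ⟨h, h'⟩
  · rw [h', ← h, Nat.ModEq, Nat.add_mod_left]
  · rw [h', mul_comm, pow_mul, Nat.ModEq.comm, Nat.modEq_iff_dvd]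
    refine ⟨2 ^ D.exponent - 1, ?_⟩
    rw [h]
    push_cast
    ring

theorem pow_period_modEq {a : ℕ} (ha : a.Coprime D.modulus) :
    a ^ D.period ≡ 1 [MOD D.modulus] := by
  rcases Nat.eq_zero_or_pos D.modulus with h0 | hpos
  · have := D.odd_modulus
    rw [h0] at this
    exact absurd this (by decide)
  have h1 : or (!(Nat.beq (Nat.gcd (a % D.modulus) D.modulus) 1))
      (Nat.beq ((a % D.modulus) ^ D.period % D.modulus) 1) = true :=
    allLt_eq_true.mp D.pow_period (a % D.modulus) (Nat.mod_lt _ hpos)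
  have h2 : (a % D.modulus).gcd D.modulus = 1 := by
    rw [← Nat.gcd_rec, Nat.gcd_comm]
    exact ha
  rw [h2] at h1
  have h3 : (a % D.modulus) ^ D.period % D.modulus = 1 := by
    simpa [← Nat.beq_eq] using h1
  have h4 : (a % D.modulus) ^ D.period ≡ a ^ D.period [MOD D.modulus] := (Nat.mod_modEq _ _).pow _
  refine h4.symm.trans ?_
  rw [Nat.ModEq, h3]
  rcases Nat.lt_or_ge 1 D.modulus with h | h
  · rw [Nat.mod_eq_of_lt h]
  · have : D.modulus = 1 := by omega
    rw [this, Nat.mod_one] at h3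
    omega

theorem pow_modEq_pow_mod {a : ℕ} (ha : a.Coprime D.modulus) (k : ℕ) :
    a ^ k ≡ a ^ (k % D.period) [MOD D.modulus] := by
  conv_lhs => rw [← Nat.div_add_mod k D.period, pow_add, pow_mul]
  simpa using ((D.pow_period_modEq ha).pow (k / D.period)).mul_right (a ^ (k % D.period))

end ReciprocityModulus

namespace SieveTest

theorem powMod_eq (a r N : ℕ) : powMod a r N = a ^ r % N := by
  change ((a ^ (r / 256) % N) ^ 256 * a ^ (r % 256)) % N = _
  have h : (a ^ (r / 256) % N) ^ 256 ≡ (a ^ (r / 256)) ^ 256 [MOD N] := (Nat.mod_modEq _ _).pow _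
  have h2 := h.mul_right (a ^ (r % 256))
  rwa [← pow_mul, ← pow_add, Nat.div_add_mod'] at h2

theorem diffMod_modEq {m p n r N : ℕ} (hN : 0 < N) (h : m ^ p + 8 ^ n = 9 ^ n)
    (h9 : 9 ^ n ≡ 9 ^ r [MOD N]) (h8 : 8 ^ n ≡ 8 ^ r [MOD N]) : m ^ p ≡ diffMod r N [MOD N] := by
  change m ^ p ≡ (powMod 9 r N + (N - powMod 8 r N)) % N [MOD N]
  rw [powMod_eq, powMod_eq]
  refine Nat.ModEq.trans ?_ (Nat.mod_modEq _ _).symm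
  apply Nat.ModEq.add_right_cancel (h8.trans (Nat.mod_modEq (8 ^ r) N).symm)
  rw [h, add_assoc, Nat.sub_add_cancel (Nat.mod_lt _ hN).le]
  refine (h9.trans (Nat.mod_modEq _ _).symm).trans ?_
  rw [Nat.ModEq, Nat.add_mod_right]

theorem jacobiSym_prod_of_signTest {a : ℕ} : ∀ {fs : List ℕ} {neg : Bool}, (∀ f ∈ fs, f.Prime) →
    Odd fs.prod → signTest a fs neg = true → jacobiSym a fs.prod = if neg then -1 else 1
  | [], neg, _, _, h => by
    cases neg
    · simp
    · simp [signTest] at h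
  | f :: fs, neg, hp, hodd, h => by
    have hf : f.Prime := hp f List.mem_cons_self
    have : Fact f.Prime := ⟨hf⟩
    rw [List.prod_cons, Nat.odd_mul] at hodd
    have hfs : ∀ g ∈ fs, g.Prime := fun g hg => hp g (List.mem_cons_of_mem _ hg)
    have : NeZero f := ⟨hf.ne_zero⟩
    have : NeZero fs.prod := ⟨by rintro h0; rw [h0] at hodd; exact absurd hodd.2 (by decide)⟩
    rw [List.prod_cons, jacobiSym.mul_right, ← jacobiSym.legendreSym.to_jacobiSym]
    have hv : ((legendreSym f a : ℤ) : ZMod f) = ((a ^ (f / 2) % f : ℕ) : ZMod f) := by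
      rw [legendreSym.eq_pow, ZMod.natCast_mod]
      push_cast
      rfl
    have h' : (bif Nat.beq (a ^ (f / 2) % f) 0 then false else
      signTest a fs (bif Nat.beq (a ^ (f / 2) % f) 1 then neg else !neg)) = true := h
    rcases Nat.eq_zero_or_pos (a ^ (f / 2) % f) with h0 | hpos
    · simp [h0] at h'
    have h1 : Nat.beq (a ^ (f / 2) % f) 0 = false := by
      rw [Bool.eq_false_iff, Ne, Nat.beq_eq]
      omega
    rw [h1, cond_false] at h'
    have ih := jacobiSym_prod_of_signTest hfs hodd.2 h'
    rw [ih]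
    have ha : ((a : ℤ) : ZMod f) ≠ 0 := by
      intro h0
      rw [legendreSym.eq_pow, h0, zero_pow (by have := hf.two_le; omega), eq_comm,
        ZMod.natCast_eq_zero_iff] at hv
      exact absurd (Nat.le_of_dvd hpos hv) (by have := Nat.mod_lt (a ^ (f / 2)) hf.pos; omega)
    rcases legendreSym.eq_one_or_neg_one f ha with hl | hl
    · have h2 : a ^ (f / 2) % f = 1 := by
        rw [hl, Int.cast_one, ← Nat.cast_one, ZMod.natCast_eq_natCast_iff, Nat.ModEq, Nat.mod_mod,
          Nat.mod_eq_of_lt hf.one_lt] at hv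
        exact hv.symm
      rw [h2, hl]
      simp
    · have h2 : a ^ (f / 2) % f ≠ 1 := by
        intro h2
        rw [hl, h2] at hv
        have h3 : ((2 : ℕ) : ZMod f) = 0 := by
          push_cast at hv ⊢
          linear_combination -hv
        rw [ZMod.natCast_eq_zero_iff] at h3
        have := Nat.le_of_dvd (by norm_num) h3
        have := hf.two_le
        have h4 : f = 2 := by omega
        rw [h4] at hodd
        exact absurd hodd.1 (by decide)
      have h3 : Nat.beq (a ^ (f / 2) % f) 1 = false := by
        rw [Bool.eq_false_iff, Ne, Nat.beq_eq]
        exact h2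
      rw [h3, hl]
      cases neg <;> simp

set_option exponentiation.threshold 1000 in
theorem not_excludes_reciprocity {m p n : ℕ} (h : PrimePowerSolution m p n)
    (D : ReciprocityModulus) : excludes p n (reciprocity D) = false := by
  by_contra hcon
  rw [Bool.not_eq_false] at hcon
  set d := p ^ 959 % D.period with hd
  set x := diffMod (n % D.period) D.modulus with hx
  have hcon' : (and (Nat.beq (p * d % D.period) 1) (and (Nat.beq (Nat.gcd x D.modulus) 1)
      (signTest (x ^ d % D.modulus + 2 ^ (3 * n * d % D.order)) D.factors true))) = true := hcon
  rw [Bool.and_eq_true, Bool.and_eq_true, Nat.beq_eq, Nat.beq_eq] at hcon'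
  obtain ⟨hpd, hxN, hsign⟩ := hcon'
  have hNodd := D.odd_modulus
  have h8 : Nat.Coprime 8 D.modulus := (Nat.coprime_two_left.mpr hNodd).pow_left 3
  have h9 : Nat.Coprime 9 D.modulus := D.coprime_three.pow_left 2
  have hmp : m ^ p ≡ x [MOD D.modulus] :=
    diffMod_modEq hNodd.pos h.eq (D.pow_modEq_pow_mod h9 n) (D.pow_modEq_pow_mod h8 n)
  have hmN : m.Coprime D.modulus := by
    rw [← Nat.coprime_pow_left_iff h.odd_prime.pos, Nat.Coprime, hmp.gcd_eq, hxN]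
  have hm : m ≡ x ^ d [MOD D.modulus] := by
    have h1 := D.pow_modEq_pow_mod hmN (p * d)
    rw [hpd, pow_one, pow_mul] at h1
    exact h1.symm.trans (hmp.pow d)
  have h2 : 2 ^ (3 * n * d) ≡ 2 ^ (3 * n * d % D.order) [MOD D.modulus] := by
    conv_lhs => rw [← Nat.div_add_mod (3 * n * d) D.order, pow_add, pow_mul]
    simpa using (D.two_pow_order_modEq.pow (3 * n * d / D.order)).mul_right
      (2 ^ (3 * n * d % D.order))
  obtain ⟨σ, hσ, hσ'⟩ := D.modulus_eq_sub
  obtain ⟨c, hc⟩ := D.order_dvd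
  have hdiv := Nat.div_add_mod (p * d) D.period
  rw [hpd] at hdiv
  have he : ∃ i, p * (3 * n * d) = 3 * n + i * D.exponent ∧ (σ = 1 ∨ σ = -1 ∧ Even i) := by
    have h1 : p * (3 * n * d) = 3 * n + 3 * n * (c * (p * d / D.period)) * D.order := by
      calc p * (3 * n * d) = 3 * n * (p * d) := by ring
        _ = 3 * n * (D.order * c * (p * d / D.period) + 1) := by rw [← hc, hdiv]
        _ = _ := by ring
    rcases hσ' with ⟨h3, h4⟩ | ⟨h3, h4⟩
    · exact ⟨_, h4 ▸ h1, Or.inl h3⟩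
    · refine ⟨3 * n * (c * (p * d / D.period)) * 2, ?_, Or.inr ⟨h3, even_two.mul_left _⟩⟩
      rw [h1, h4]
      ring
  obtain ⟨i, hi, hσi⟩ := he
  refine jacobiSym_add_two_pow_ne_neg_one h.mod_eight h.one_lt h.odd_prime h.two_mul_le h.coprime
    h.sq D.exponent_pos hσ hi hσi ?_
  have hJ := jacobiSym_prod_of_signTest D.prime_factors (by rwa [D.prod_factors]) hsign
  rw [D.prod_factors, if_pos rfl] at hJ
  rw [← hJ]
  apply jacobiSym.mod_left'
  have := (hm.trans (Nat.mod_modEq _ _).symm).add h2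
  have h5 := (Int.natCast_modEq_iff.mpr this)
  push_cast at h5 ⊢
  exact h5

theorem prime_of_wellFormed {p q : ℕ} (h : wellFormed p (residue q) = true) :
    q.Prime ∧ q % p = 1 := by
  have h' : ((Nat.blt 1 q = true ∧ Nat.blt q 338724 = true) ∧ Nat.beq (q % p) 1 = true) ∧
      allLt (fun d => or (Nat.ble q (d + 2)) (Nat.blt 0 (q % (d + 2)))) 580 = true := by
    rw [← Bool.and_eq_true, ← Bool.and_eq_true, ← Bool.and_eq_true]
    exact h
  obtain ⟨⟨⟨h1, hlt⟩, hmod⟩, htrial⟩ := h'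
  rw [Nat.blt_eq] at h1 hlt
  rw [Nat.beq_eq] at hmod
  refine ⟨?_, hmod⟩
  by_contra hq
  have hsq := Nat.minFac_sq_le_self (by omega) hq
  have h2 := (Nat.minFac_prime (n := q) (by omega)).two_le
  have ht := allLt_eq_true.mp htrial (q.minFac - 2) (by
    have : q.minFac < 582 := by nlinarith
    omega)
  rw [Nat.sub_add_cancel h2, Nat.mod_eq_zero_of_dvd q.minFac_dvd, Bool.or_eq_true, Nat.ble_eq] at ht
  rcases ht with ht | ht
  · have := Nat.mul_le_mul_right q.minFac h2
    rw [pow_two] at hsq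
    omega
  · exact absurd ht (by decide)

theorem not_excludes_residue {m p n q : ℕ} (h : PrimePowerSolution m p n)
    (hq : wellFormed p (residue q) = true) : excludes p n (residue q) = false := by
  obtain ⟨hprime, hmod⟩ := prime_of_wellFormed hq
  have hp := h.five_le
  have hdvd : p ∣ q - 1 := (Nat.modEq_iff_dvd' hprime.one_lt.le).mp (by
    rw [Nat.ModEq, hmod, Nat.mod_eq_of_lt (by omega)])
  have hpq : p ≤ q - 1 := Nat.le_of_dvd (by have := hprime.one_lt; omega) hdvd
  have pow_modEq : ∀ {a : ℕ}, a.Coprime q → a ^ (q - 1) ≡ 1 [MOD q] := fun ha => by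
    rw [← Nat.totient_prime hprime]
    exact Nat.ModEq.pow_totient ha
  have pow_mod : ∀ {a : ℕ}, a.Coprime q → a ^ n ≡ a ^ (n % (q - 1)) [MOD q] := fun {a} ha => by
    conv_lhs => rw [← Nat.div_add_mod n (q - 1), pow_add, pow_mul]
    simpa using ((pow_modEq ha).pow (n / (q - 1))).mul_right (a ^ (n % (q - 1)))
  have h8 : Nat.Coprime 8 q := Nat.Coprime.pow_left 3
    ((Nat.coprime_primes Nat.prime_two hprime).mpr (by omega))
  have h9 : Nat.Coprime 9 q := Nat.Coprime.pow_left 2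
    ((Nat.coprime_primes Nat.prime_three hprime).mpr (by omega))
  have hx := (diffMod_modEq hprime.pos h.eq (pow_mod h9) (pow_mod h8)).pow ((q - 1) / p)
  rw [← pow_mul, Nat.mul_div_cancel' hdvd] at hx
  have hle : diffMod (n % (q - 1)) q ^ ((q - 1) / p) % q ≤ 1 := by
    rw [← hx]
    by_cases hm : q ∣ m
    · rw [Nat.mod_eq_zero_of_dvd (hm.trans (dvd_pow_self m (by omega)))]
      exact zero_le_one
    · have := pow_modEq ((Nat.Prime.coprime_iff_not_dvd hprime).mpr hm).symm
      rw [this]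
      exact Nat.mod_le _ _
  rw [Bool.eq_false_iff]
  intro hcon
  have hcon' : Nat.ble 2 (diffMod (n % (q - 1)) q ^ ((q - 1) / p) % q) = true := hcon
  rw [Nat.ble_eq] at hcon'
  omega

theorem not_excludes {m p n : ℕ} (h : PrimePowerSolution m p n) {t : SieveTest}
    (ht : wellFormed p t = true) : excludes p n t = false := by
  cases t with
  | reciprocity D => exact not_excludes_reciprocity h D
  | residue q => exact not_excludes_residue h ht

set_option exponentiation.threshold 1000 in
theorem excludes_congr {p n n' : ℕ} {t : SieveTest} (h : n ≡ n' [MOD t.period]) :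
    excludes p n t = excludes p n' t := by
  cases t with
  | reciprocity D =>
    have h1 : n % D.period = n' % D.period := h
    have h2 : 3 * n * (p ^ 959 % D.period) % D.order = 3 * n' * (p ^ 959 % D.period) % D.order :=
      ((Nat.ModEq.of_dvd D.order_dvd h).mul_left 3).mul_right _
    cases D with
    | mk j N o fs P =>
      change n % P = n' % P at h1
      change 3 * n * (p ^ 959 % P) % o = 3 * n' * (p ^ 959 % P) % o at h2
      change (and (Nat.beq (p * (p ^ 959 % P) % P) 1) (and (Nat.beq (Nat.gcd (diffMod (n % P) N) N) 1)
        (signTest (diffMod (n % P) N ^ (p ^ 959 % P) % N + 2 ^ (3 * n * (p ^ 959 % P) % o)) fs true)))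
        = (and (Nat.beq (p * (p ^ 959 % P) % P) 1)
          (and (Nat.beq (Nat.gcd (diffMod (n' % P) N) N) 1) (signTest
            (diffMod (n' % P) N ^ (p ^ 959 % P) % N + 2 ^ (3 * n' * (p ^ 959 % P) % o)) fs true)))
      rw [h1, h2]
  | residue q =>
    have h1 : n % (q - 1) = n' % (q - 1) := h
    change Nat.ble 2 (diffMod (n % (q - 1)) q ^ ((q - 1) / p) % q) =
      Nat.ble 2 (diffMod (n' % (q - 1)) q ^ ((q - 1) / p) % q)
    rw [h1]

theorem sieve_eq_false {m p n : ℕ} (h : PrimePowerSolution m p n) : ∀ {ts : List SieveTest}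
    {M r : ℕ}, (∀ t ∈ ts, wellFormed p t = true ∧ 0 < t.period) → 0 < M → r < M → n ≡ r [MOD M] →
    sieve p ts M r = false
  | [], _, _, _, _, _, _ => rfl
  | t :: ts, M, r, hts, hM, hr, hn => by
    rw [Bool.eq_false_iff]
    intro hcon
    obtain ⟨ht, hper⟩ := hts t List.mem_cons_self
    have hlcm : 0 < M.lcm t.period := Nat.lcm_pos hM hper
    have hall := allLt_eq_true.mp (show allLt (fun i => or (t.excludes p (r + M * i))
      (sieve p ts (M.lcm t.period) (r + M * i))) (M.lcm t.period / M) = true from hcon)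
    set n' := n % M.lcm t.period with hn'
    have hlt : n' < M.lcm t.period := Nat.mod_lt _ hlcm
    have hmod : n' % M = r := by
      rw [hn', Nat.mod_mod_of_dvd _ (Nat.dvd_lcm_left _ _), hn, Nat.mod_eq_of_lt hr]
    have hi : r + M * (n' / M) = n' := by
      rw [← hmod, Nat.mod_add_div]
    have hcase := hall (n' / M) (Nat.div_lt_div_of_lt_of_dvd (Nat.dvd_lcm_left _ _) hlt)
    rw [hi, sieve_eq_false h (fun t ht => hts t (List.mem_cons_of_mem _ ht)) hlcm hlt
      (Nat.mod_modEq _ _).symm, Bool.or_false, ← excludes_congr (n := n), not_excludes h ht] at hcase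
    · exact absurd hcase (by decide)
    · exact (Nat.ModEq.of_dvd (Nat.dvd_lcm_right _ _) (Nat.mod_modEq _ _)).symm

theorem period_pos {p : ℕ} {t : SieveTest} (ht : wellFormed p t = true) : 0 < t.period := by
  cases t with
  | reciprocity D => exact D.period_pos
  | residue q =>
    have := (prime_of_wellFormed ht).1.one_lt
    change 0 < q - 1
    omega

theorem sieve_ne_true {m p n : ℕ} (h : PrimePowerSolution m p n) {ts : List SieveTest}
    (hts : ∀ t ∈ ts, wellFormed p t = true) : sieve p ts 2 1 ≠ true := by
  rw [sieve_eq_false h (fun t ht => ⟨hts t ht, period_pos (hts t ht)⟩) two_pos one_lt_two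
    (Nat.odd_iff.mp h.odd)]
  decide

def rec2 : SieveTest :=
  .reciprocity ⟨2, 5, 4, [5], 4, by norm_num, by norm_num,
    by norm_num, by norm_num, by norm_num, by norm_num, by norm_num,
    by decide +kernel⟩

def rec3 : SieveTest :=
  .reciprocity ⟨3, 7, 3, [7], 6, by norm_num, by norm_num,
    by norm_num, by norm_num, by norm_num, by norm_num, by norm_num,
    by decide +kernel⟩

def rec4 : SieveTest :=
  .reciprocity ⟨4, 17, 8, [17], 16, by norm_num, by norm_num,
    by norm_num, by norm_num, by norm_num, by norm_num, by norm_num,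
    by decide +kernel⟩

def rec5 : SieveTest :=
  .reciprocity ⟨5, 31, 5, [31], 30, by norm_num, by norm_num,
    by norm_num, by norm_num, by norm_num, by norm_num, by norm_num,
    by decide +kernel⟩

def rec6 : SieveTest :=
  .reciprocity ⟨6, 65, 12, [5, 13], 12, by norm_num, by norm_num,
    by norm_num, by norm_num, by norm_num, by norm_num, by norm_num,
    by decide +kernel⟩

def rec7 : SieveTest :=
  .reciprocity ⟨7, 127, 7, [127], 126, by norm_num, by norm_num,
    by norm_num, by norm_num, by norm_num, by norm_num, by norm_num,
    by decide +kernel⟩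

def rec8 : SieveTest :=
  .reciprocity ⟨8, 257, 16, [257], 256, by norm_num, by norm_num,
    by norm_num, by norm_num, by norm_num, by norm_num, by norm_num,
    by decide +kernel⟩

def rec10 : SieveTest :=
  .reciprocity ⟨10, 1025, 20, [5, 5, 41], 40, by norm_num, by norm_num,
    by norm_num, by norm_num, by norm_num, by norm_num, by norm_num,
    by decide +kernel⟩

def rec11 : SieveTest :=
  .reciprocity ⟨11, 2047, 11, [23, 89], 88, by norm_num, by norm_num,
    by norm_num, by norm_num, by norm_num, by norm_num, by norm_num,
    by decide +kernel⟩

def rec14 : SieveTest :=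
  .reciprocity ⟨14, 16385, 28, [5, 29, 113], 112, by norm_num, by norm_num,
    by norm_num, by norm_num, by norm_num, by norm_num, by norm_num,
    by decide +kernel⟩

/-- Tests for the primes from `7` to `607` not covered by the default tests. -/
def sieveTable₁ : List (ℕ × List SieveTest) :=
  [(7, [rec2, .residue 113]), (17, [.residue 103, .residue 409, rec5]),
   (31, [rec2, .residue 373, .residue 1117]),
   (41, [.residue 83, .residue 1231, .residue 3691, .residue 2707, rec11]),
   (73, [.residue 293, .residue 877, rec5]), (79, [rec2, .residue 317]),
   (89, [.residue 179, .residue 2671, rec10]), (97, [.residue 389, .residue 971, rec10]),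
   (103, [rec2, .residue 619, .residue 1237]), (113, [.residue 227, .residue 3391, rec5]),
   (127, [rec2, .residue 509]), (137, [rec3, .residue 823, .residue 2741, rec5]),
   (151, [rec2, .residue 907, .residue 5437]),
   (193, [.residue 773, .residue 3089, .residue 21617, rec14]),
   (199, [rec2, .residue 797, .residue 2389]), (223, [rec2, .residue 2677, .residue 6691]),
   (233, [.residue 467, .residue 2797, rec5]),
   (241, [.residue 1447, .residue 14461, .residue 16871, rec7, .residue 26029]),
   (257, [rec3, .residue 1543, .residue 21589, .residue 16963, rec11]),
   (271, [rec2, .residue 3253, .residue 1627]),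
   (281, [.residue 563, .residue 35969, .residue 143873, rec8]),
   (313, [.residue 1879, .residue 13147, .residue 26293, rec5]),
   (337, [.residue 3371, .residue 10111, rec5]),
   (353, [.residue 4943, .residue 14827, .residue 36007, rec5]),
   (367, [.residue 2203, .residue 6607, rec5]),
   (401, [rec3, rec6, .residue 4813, .residue 16843, rec7]),
   (409, [.residue 1637, .residue 4091, rec10]),
   (433, [.residue 1733, .residue 32909, .residue 49363, rec5]),
   (439, [rec2, .residue 4391, .residue 36877]),
   (449, [rec3, rec6, .residue 3593, .residue 53881, rec10]),
   (457, [rec5, .residue 13711, .residue 41131]), (463, [rec2, .residue 5557, .residue 11113]),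
   (487, [rec2, .residue 1949, .residue 7793]),
   (521, [rec3, rec6, .residue 18757, .residue 65647, rec7]),
   (569, [rec3, rec6, .residue 6829, .residue 34141, rec10]),
   (577, [.residue 2309, .residue 3463, rec5]), (593, [.residue 1187, .residue 3559, rec5]),
   (601, [.residue 16829, rec14, .residue 57697]), (607, [rec2, .residue 3643, .residue 29137])]

/-- Tests for the primes from `617` to `967` not covered by the default tests. -/
def sieveTable₂ : List (ℕ × List SieveTest) :=
  [(617, [rec3, rec6, .residue 4937, .residue 37021, rec5]),
   (631, [rec2, .residue 7573, .residue 22717]),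
   (641, [.residue 1283, .residue 3847, .residue 38461, .residue 42307, rec11]),
   (673, [.residue 2693, .residue 24229, rec5]), (727, [rec2, .residue 2909, .residue 4363]),
   (751, [rec2, .residue 9013, .residue 4507]),
   (761, [.residue 1523, .residue 27397, .residue 31963, rec7]),
   (769, [.residue 7691, .residue 23071, rec10]), (809, [.residue 1619, .residue 48541, rec10]),
   (823, [.residue 8231, rec5, .residue 19753]),
   (857, [rec3, rec6, .residue 6857, .residue 30853, rec5]),
   (881, [rec3, .residue 15859, .residue 26431, .residue 70481, rec14, .residue 37003]),
   (919, [rec2, .residue 3677, .residue 25733]),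
   (929, [rec3, rec6, .residue 11149, .residue 100333, .residue 13007, rec7]),
   (937, [.residue 5623, .residue 28111, rec5, .residue 9371]),
   (953, [.residue 1907, .residue 11437, rec5]), (967, [rec2, .residue 15473])]

/-- Tests for the primes from `977` to `1153` not covered by the default tests. -/
def sieveTable₃ : List (ℕ × List SieveTest) :=
  [(977, [.residue 7817, .residue 19541, rec10]), (991, [rec2, .residue 27749, .residue 69371]),
   (1009, [.residue 10091, .residue 30271, rec10]), (1033, [.residue 4133, .residue 6199, rec5]),
   (1039, [rec2, .residue 4157]), (1049, [.residue 2099, .residue 20981, rec10]),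
   (1063, [rec2, .residue 4253, .residue 6379]), (1087, [rec2, .residue 4349]),
   (1097, [rec5, .residue 32911, .residue 98731]), (1129, [.residue 4517, .residue 33871, rec10]),
   (1153, [rec5, .residue 34591, .residue 207541])]

/-- Tests for the primes from `1193` to `1327` not covered by the default tests. -/
def sieveTable₄ : List (ℕ × List SieveTest) :=
  [(1193, [rec3, .residue 7159, .residue 100213, rec7]),
   (1201, [.residue 7207, .residue 43237, .residue 33629, rec7]),
   (1217, [rec3, rec6, .residue 29209, .residue 58417, rec5]),
   (1231, [rec2, .residue 19697, .residue 34469]), (1249, [.residue 12491, .residue 74941, rec10]),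
   (1279, [rec2, .residue 15349, .residue 30697]), (1289, [.residue 2579, .residue 38671, rec10]),
   (1297, [.residue 5189, .residue 108949, rec14]), (1303, [rec2, .residue 20849, .residue 52121]),
   (1321, [.residue 7927, .residue 237781, .residue 277411, rec7]),
   (1327, [rec2, .residue 5309, .residue 7963])]

/-- Tests for the primes from `1361` to `1543` not covered by the default tests. -/
def sieveTable₅ : List (ℕ × List SieveTest) :=
  [(1361, [rec3, .residue 8167, .residue 146989, rec7, .residue 57163]),
   (1399, [rec2, .residue 33577, .residue 67153]), (1409, [.residue 2819, .residue 19727, rec14]),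
   (1423, [rec2, .residue 5693, .residue 8539]),
   (1433, [rec3, .residue 8599, .residue 28661, rec5]),
   (1447, [rec5, .residue 43411, .residue 34729]), (1471, [rec2, .residue 23537, .residue 41189]),
   (1481, [.residue 2963, .residue 195493, rec11]),
   (1489, [.residue 14891, .residue 104231, rec10]), (1543, [rec2, .residue 6173])]

/-- Tests for the primes from `1553` to `1697` not covered by the default tests. -/
def sieveTable₆ : List (ℕ × List SieveTest) :=
  [(1553, [rec3, .residue 9319, .residue 18637, rec5]),
   (1567, [rec2, .residue 6269, .residue 9403]),
   (1601, [.residue 3203, .residue 57637, .residue 336211, rec7]), (1609, [.residue 16091, rec10]),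
   (1657, [rec5, .residue 49711, .residue 198841]), (1663, [rec2, .residue 6653]),
   (1697, [rec3, rec6, .residue 13577, .residue 81457, rec5])]

/-- Tests for the primes from `1721` to `1753` not covered by the default tests. -/
def sieveTable₇ : List (ℕ × List SieveTest) :=
  [(1721, [rec3, .residue 82609, .residue 96377, rec14]),
   (1753, [.residue 7013, .residue 38567, rec11])]

/-- Tests for the primes from `1759` to `1831` not covered by the default tests. -/
def sieveTable₈ : List (ℕ × List SieveTest) :=
  [(1759, [rec2, .residue 49253, .residue 197009]), (1777, [.residue 7109, .residue 10663, rec5]),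
   (1783, [rec2, .residue 21397, .residue 42793]), (1801, [.residue 21613, .residue 39623, rec11]),
   (1831, [rec2, .residue 10987, .residue 29297])]

/-- Tests for the primes from `1873` to `1993` not covered by the default tests. -/
def sieveTable₉ : List (ℕ × List SieveTest) :=
  [(1873, [.residue 11239, .residue 67429, rec5]), (1879, [rec2, .residue 7517, .residue 22549]),
   (1889, [.residue 3779, .residue 37781, rec10]),
   (1913, [rec3, rec6, rec5, .residue 38261, .residue 114781]),
   (1951, [rec2, .residue 54629, .residue 81943]), (1993, [.residue 11959, .residue 23917, rec5])]

/-- Tests for the primes from `1999` to `2089` not covered by the default tests. -/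
def sieveTable₁₀ : List (ℕ × List SieveTest) :=
  [(1999, [rec2, .residue 19991, .residue 47977]), (2017, [.residue 8069, .residue 36307, rec5]),
   (2081, [rec3, .residue 12487, .residue 87403, rec14]),
   (2089, [.residue 45959, .residue 87739, .residue 112807, rec7])]

/-- Whether the tests attached to each prime of the table are well formed and exclude all odd `n`. -/
def checkTable (T : List (ℕ × List SieveTest)) : Bool :=
  T.all fun x => and (x.2.all (wellFormed x.1)) (sieve x.1 x.2 2 1)

set_option maxHeartbeats 0 in
theorem check_sieveTable₁ : checkTable sieveTable₁ = true := by decide +kernel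

set_option maxHeartbeats 0 in
theorem check_sieveTable₂ : checkTable sieveTable₂ = true := by decide +kernel

set_option maxHeartbeats 0 in
theorem check_sieveTable₃ : checkTable sieveTable₃ = true := by decide +kernel

set_option maxHeartbeats 0 in
theorem check_sieveTable₄ : checkTable sieveTable₄ = true := by decide +kernel

set_option maxHeartbeats 0 in
theorem check_sieveTable₅ : checkTable sieveTable₅ = true := by decide +kernel

set_option maxHeartbeats 0 in
theorem check_sieveTable₆ : checkTable sieveTable₆ = true := by decide +kernel

set_option maxHeartbeats 0 in
theorem check_sieveTable₇ : checkTable sieveTable₇ = true := by decide +kernel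

set_option maxHeartbeats 0 in
theorem check_sieveTable₈ : checkTable sieveTable₈ = true := by decide +kernel

set_option maxHeartbeats 0 in
theorem check_sieveTable₉ : checkTable sieveTable₉ = true := by decide +kernel

set_option maxHeartbeats 0 in
theorem check_sieveTable₁₀ : checkTable sieveTable₁₀ = true := by decide +kernel

def sieveTable : List (ℕ × List SieveTest) :=
  sieveTable₁ ++ sieveTable₂ ++ sieveTable₃ ++ sieveTable₄ ++ sieveTable₅ ++
    sieveTable₆ ++ sieveTable₇ ++ sieveTable₈ ++ sieveTable₉ ++ sieveTable₁₀

theorem check_sieveTable : checkTable sieveTable = true := by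
  simp only [sieveTable, checkTable, List.all_append, Bool.and_eq_true]
  exact ⟨⟨⟨⟨⟨⟨⟨⟨⟨check_sieveTable₁, check_sieveTable₂⟩, check_sieveTable₃⟩,
    check_sieveTable₄⟩, check_sieveTable₅⟩, check_sieveTable₆⟩, check_sieveTable₇⟩,
    check_sieveTable₈⟩, check_sieveTable₉⟩, check_sieveTable₁₀⟩

/-- The tests used for the primes outside `sieveTable`. -/
def defaultTests : List SieveTest := [rec2, rec3, rec6, rec4]

theorem check_defaultTests : ∀ p < 2100, p < 5 ∨
    (∃ q ∈ [2, 3, 5, 7, 11, 13, 17, 19, 23, 29, 31, 37, 41, 43], q ∣ p ∧ q ≠ p) ∨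
    p ∈ sieveTable.map Prod.fst ∨ sieve p defaultTests 2 1 = true := by
  decide +kernel

end SieveTest

theorem PrimePowerSolution.exponent_ge {m p n : ℕ} (h : PrimePowerSolution m p n) : 2100 ≤ p := by
  by_contra! hlt
  rcases check_defaultTests p hlt with h5 | ⟨q, hq, hqp, hne⟩ | hmem | hsieve
  · exact absurd h.five_le (by omega)
  · rcases (Nat.dvd_prime h.prime).mp hqp with rfl | rfl
    · exact absurd hq (by decide)
    · exact hne rfl
  · obtain ⟨⟨p', ts⟩, hx, rfl⟩ := List.mem_map.mp hmem
    have hx' := List.all_eq_true.mp check_sieveTable _ hx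
    rw [Bool.and_eq_true, List.all_eq_true] at hx'
    exact sieve_ne_true h hx'.1 hx'.2
  · refine sieve_ne_true h (fun t ht => ?_) hsieve
    simp only [defaultTests, List.mem_cons, List.not_mem_nil, or_false] at ht
    rcases ht with rfl | rfl | rfl | rfl <;> rfl

namespace Matrix

theorem exists_submatrix_det_ne_zero {m n K : Type*} [Field K] [Finite m] [Fintype n]
    [DecidableEq n] {A : Matrix m n K} (h : ∀ v, A *ᵥ v = 0 → v = 0) :
    ∃ f : n → m, (A.submatrix f id).det ≠ 0 := by
  have hker : LinearMap.ker A.mulVecLin = ⊥ := by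
    rw [LinearMap.ker_eq_bot']
    exact h
  have hrank : Module.finrank K (Submodule.span K (Set.range A.row)) = Fintype.card n := by
    rw [← rank_eq_finrank_span_row, Matrix.rank,
      LinearMap.finrank_range_of_inj (LinearMap.ker_eq_bot.mp hker), Module.finrank_fintype_fun_eq_card]
  obtain ⟨g, hg, -, hli⟩ := Submodule.exists_fun_fin_finrank_span_eq K (Set.range A.row)
  choose f hf using hg
  let e : n ≃ Fin (Module.finrank K (Submodule.span K (Set.range A.row))) :=
    Fintype.equivFinOfCardEq hrank.symm
  refine ⟨f ∘ e, ?_⟩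
  have hrow : (A.submatrix (f ∘ e) id).row = g ∘ e := by
    ext i j
    rw [Function.comp_apply, ← hf (e i)]
    rfl
  rw [← isUnit_iff_ne_zero, ← Matrix.isUnit_iff_isUnit_det, ← linearIndependent_rows_iff_isUnit, hrow]
  exact hli.comp _ e.injective

/-- Rows that are combinations of `d ^ h • b h` for `h < N`, up to multiples of `d ^ N`, have a
determinant divisible by `d ^ (0 + 1 + ⋯ + (N - 1))`. -/
theorem pow_dvd_det {ι : Type*} [Fintype ι] [DecidableEq ι] {N : ℕ} (hN : Fintype.card ι = N)
    {d : ℤ} (hd : d ≠ 0) {M : Matrix ι ι ℤ} (U : ι → ℕ → ℤ) (B : ℕ → ι → ℤ)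
    (h : ∀ i j, d ^ N ∣ M i j - ∑ h ∈ Finset.range N, d ^ h * U i h * B h j) :
    d ^ (∑ h ∈ Finset.range N, h) ∣ M.det := by
  choose E hE using h
  let D : Matrix (Fin N) (Fin N) ℤ := diagonal fun h => d ^ (h : ℕ)
  let D' : Matrix (Fin N) (Fin N) ℤ := diagonal fun h => d ^ (N - (h : ℕ))
  let U' : Matrix ι (Fin N) ℤ := of fun i h => U i h
  let B' : Matrix (Fin N) ι ℤ := of fun h j => B h j
  let E' : Matrix ι ι ℤ := of E
  have hM : M = U' * D * B' + d ^ N • E' := by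
    ext i j
    have h1 := hE i j
    rw [sub_eq_iff_eq_add', ← Fin.sum_univ_eq_sum_range (fun h => d ^ h * U i h * B h j)] at h1
    rw [h1, add_apply, Matrix.mul_apply]
    congr 1
    refine Finset.sum_congr rfl fun h _ => ?_
    simp [D, U', B', mul_comm]
  have hDD : D' * D = d ^ N • 1 := by
    rw [diagonal_mul_diagonal, smul_one_eq_diagonal]
    congr 1
    ext h
    rw [← pow_add, Nat.sub_add_cancel h.2.le]
  have hblock : fromBlocks D' B' U' (-E') * fromBlocks 1 (-(D * B')) 0 (d ^ N • 1) =
      fromBlocks D' 0 U' (-M) := by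
    rw [fromBlocks_multiply, hM]
    congr 1
    · simp
    · rw [Matrix.mul_neg, ← Matrix.mul_assoc, hDD, Matrix.smul_mul, Matrix.mul_smul, Matrix.one_mul,
        Matrix.mul_one, neg_add_cancel]
    · simp
    · rw [Matrix.mul_neg, ← Matrix.mul_assoc, Matrix.mul_smul, Matrix.mul_one, smul_neg, neg_add]
  have hdet := congrArg det hblock
  rw [det_mul, det_fromBlocks_zero₂₁, det_fromBlocks_zero₁₂, det_one, one_mul, det_smul, det_one,
    mul_one, hN, det_neg] at hdet
  have hDdet : D.det = d ^ (∑ h ∈ Finset.range N, h) := by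
    rw [det_diagonal, ← Finset.prod_pow_eq_pow_sum, Fin.prod_univ_eq_prod_range (fun h => d ^ h)]
  have hDD' : D'.det * D.det = (d ^ N) ^ N := by
    rw [← det_mul, hDD, det_smul, det_one, mul_one, Fintype.card_fin]
  have hD0 : D'.det ≠ 0 := by
    intro h0
    rw [h0, zero_mul] at hDD'
    exact pow_ne_zero N (pow_ne_zero N hd) hDD'.symm
  rw [← hDD', mul_left_comm] at hdet
  have hfin := mul_left_cancel₀ hD0 hdet
  rw [← hDdet]
  have : D.det ∣ (-1) ^ Fintype.card ι * M.det := Dvd.intro_left _ hfin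
  exact (((isUnit_one.neg : IsUnit (-1 : ℤ)).pow _).dvd_mul_left).mp this

theorem abs_det_le_factorial_mul_prod {ι : Type*} [Fintype ι] [DecidableEq ι] {M : Matrix ι ι ℤ}
    {c : ι → ℤ} (h : ∀ i j, |M i j| ≤ c j) : |M.det| ≤ (Fintype.card ι).factorial * ∏ j, c j := by
  rw [det_apply]
  calc |∑ σ : Equiv.Perm ι, Equiv.Perm.sign σ • ∏ i, M (σ i) i|
      ≤ ∑ σ : Equiv.Perm ι, |Equiv.Perm.sign σ • ∏ i, M (σ i) i| := Finset.abs_sum_le_sum_abs _ _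
    _ ≤ ∑ _σ : Equiv.Perm ι, ∏ j, c j := by
        refine Finset.sum_le_sum fun σ _ => ?_
        rw [Units.smul_def, smul_eq_mul, abs_mul, Int.isUnit_iff_abs_eq.mp (Equiv.Perm.sign σ).isUnit, one_mul,
          Finset.abs_prod]
        exact Finset.prod_le_prod (fun _ _ => abs_nonneg _) fun j _ => h _ _
    _ = _ := by
        rw [Finset.sum_const, Finset.card_univ, Fintype.card_perm, nsmul_eq_mul]

end Matrix

section ZeroEstimate

open Polynomial

theorem Polynomial.natDegree_det_le {ι R : Type*} [Fintype ι] [DecidableEq ι] [CommRing R]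
    {Q : Matrix ι ι R[X]} {d : ℕ} (h : ∀ i j, (Q i j).natDegree ≤ d) :
    Q.det.natDegree ≤ Fintype.card ι * d := by
  rw [Matrix.det_apply]
  refine natDegree_sum_le_of_forall_le _ _ fun σ _ => (natDegree_smul_le _ _).trans ?_
  refine (natDegree_prod_le _ _).trans ((Finset.sum_le_card_nsmul _ _ d fun i _ => h _ _).trans_eq ?_)
  rw [Finset.card_univ, smul_eq_mul]

theorem Polynomial.coeff_det_card_mul {ι R : Type*} [Fintype ι] [DecidableEq ι] [CommRing R]
    {Q : Matrix ι ι R[X]} {d : ℕ} (h : ∀ i j, (Q i j).natDegree ≤ d) :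
    Q.det.coeff (Fintype.card ι * d) = (Matrix.of fun i j => (Q i j).coeff d).det := by
  rw [Matrix.det_apply, Matrix.det_apply, finsetSum_coeff]
  refine Finset.sum_congr rfl fun σ _ => ?_
  rw [coeff_smul, ← Finset.card_univ, coeff_prod_of_natDegree_le _ _ d fun i _ => h _ _]
  rfl

theorem det_shift_mul_pow_ne_zero {F : Type*} [Field F] {t : ℕ} {P : Fin t → F[X]}
    (hP : ∀ j, P j ≠ 0) {b : Fin t → F} (hb : Function.Injective b) (c : F) :
    (Matrix.of fun r j : Fin t => (P j).comp (X + C (r * c)) * C (b j ^ (r : ℕ))).det ≠ 0 := by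
  intro h0
  let d := Finset.univ.sup fun j => (P j).natDegree
  have hd : ∀ j, (P j).natDegree ≤ d := fun j =>
    Finset.le_sup (f := fun j => (P j).natDegree) (Finset.mem_univ j)
  have hQ : ∀ r j : Fin t, ((P j).comp (X + C (r * c)) * C (b j ^ (r : ℕ))).natDegree
      ≤ (P j).natDegree := fun r j => by
    refine (natDegree_mul_C_le _ _).trans ?_
    rw [natDegree_comp, natDegree_X_add_C, mul_one]
  have hQc : ∀ r j : Fin t, ((P j).comp (X + C (r * c)) * C (b j ^ (r : ℕ))).coeff (P j).natDegree
      = (P j).leadingCoeff * b j ^ (r : ℕ) := fun r j => by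
    have h := coeff_comp_degree_mul_degree (p := P j) (q := X + C (r * c))
      (by rw [natDegree_X_add_C]; exact one_ne_zero)
    rw [natDegree_X_add_C, mul_one, leadingCoeff_X_add_C, one_pow, mul_one] at h
    rw [coeff_mul_C, h]
  have hdet := Matrix.det_mul_row (fun j => X ^ (d - (P j).natDegree))
    (Matrix.of fun r j : Fin t => (P j).comp (X + C (r * c)) * C (b j ^ (r : ℕ)))
  rw [h0, mul_zero] at hdet
  have hcoeff := coeff_det_card_mul (d := d) (Q := Matrix.of fun r j : Fin t =>
    X ^ (d - (P j).natDegree) * ((P j).comp (X + C (r * c)) * C (b j ^ (r : ℕ)))) fun r j => by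
      rw [Matrix.of_apply]
      refine natDegree_mul_le.trans ?_
      have h1 := hQ r j
      have h2 := hd j
      rw [natDegree_X_pow]
      lia
  have hentry : (Matrix.of fun r j : Fin t => ((Matrix.of fun r j : Fin t =>
      X ^ (d - (P j).natDegree) * ((P j).comp (X + C (r * c)) * C (b j ^ (r : ℕ)))) r j).coeff d) =
      Matrix.of fun r j : Fin t => (P j).leadingCoeff * (Matrix.vandermonde b).transpose r j := by
    ext r j
    rw [Matrix.of_apply, Matrix.of_apply, Matrix.of_apply, Matrix.transpose_apply,
      Matrix.vandermonde_apply, ← hQc, coeff_X_pow_mul', if_pos (Nat.sub_le _ _),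
      Nat.sub_sub_self (hd j)]
  rw [hentry, Matrix.det_mul_row, Matrix.det_transpose] at hcoeff
  simp only [Matrix.of_apply] at hdet hcoeff
  rw [hdet, coeff_zero] at hcoeff
  refine mul_ne_zero (Finset.prod_ne_zero_iff.mpr fun j _ => ?_)
    (Matrix.det_vandermonde_ne_zero_iff.mpr hb) hcoeff.symm
  exact leadingCoeff_ne_zero.mpr (hP j)

theorem lattice_injOn {p n S : ℕ} (hpn : p.Coprime n) (hS : S ≤ p) {r s r' s' : ℕ} (hs : s < S)
    (hs' : s' < S) (h : r * p + s * n = r' * p + s' * n) : r = r' ∧ s = s' := by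
  have hmod : s * n ≡ s' * n [MOD p] := by
    have := congrArg (· % p) h
    simpa [Nat.ModEq, Nat.add_mod] using this
  have hss : s = s' := by
    have := Nat.ModEq.cancel_right_of_coprime hpn hmod
    rwa [Nat.ModEq, Nat.mod_eq_of_lt (hs.trans_le hS), Nat.mod_eq_of_lt (hs'.trans_le hS)] at this
  subst hss
  exact ⟨Nat.eq_of_mul_eq_mul_right (by lia : 0 < p) (Nat.add_right_cancel h), rfl⟩

/-- An exponential polynomial with more zeros on a lattice of points than coefficients vanishes. -/
theorem eq_zero_of_sum_eval_mul_pow_eq_zero {L K ρ S p n : ℕ} {a m : ℚ}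
    (ha : Function.Injective fun i : ℕ => a ^ i) (ha0 : a ≠ 0) (hm : m ≠ 0) (hpn : p.Coprime n)
    (hS : S ≤ p) (hK : 0 < K) (hKL : K * L ≤ ρ * S) {P : Fin L → ℚ[X]}
    (hdeg : ∀ l, (P l).natDegree < K)
    (h : ∀ r < ρ + L, ∀ s < S,
      ∑ l, (P l).eval ((r * p + s * n : ℕ) : ℚ) * (a ^ r * m ^ s) ^ (l : ℕ) = 0) : P = 0 := by
  classical
  by_contra hP
  obtain ⟨l₀, hl₀⟩ := Function.ne_iff.mp hP
  let T : Type := {l : Fin L // P l ≠ 0}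
  let t := Fintype.card T
  let e : Fin t ≃ T := (Fintype.equivFin T).symm
  have htL : t ≤ L := (Fintype.card_subtype_le _).trans_eq (Fintype.card_fin L)
  have ht : 0 < t := Fintype.card_pos_iff.mpr ⟨⟨l₀, hl₀⟩⟩
  let Q : Matrix (Fin t) (Fin t) ℚ[X] := Matrix.of fun r j =>
    (P (e j).1).comp (X + C (r * p : ℚ)) * C ((a ^ ((e j).1 : ℕ)) ^ (r : ℕ))
  have hQ : Q.det ≠ 0 := det_shift_mul_pow_ne_zero (fun j => (e j).2)
    (fun i j hij => e.injective (Subtype.ext (Fin.ext (ha hij)))) _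
  have hQdeg : Q.det.natDegree ≤ t * (K - 1) := by
    refine (natDegree_det_le (d := K - 1) fun r j => ?_).trans_eq (by rw [Fintype.card_fin])
    rw [show Q r j = _ from Matrix.of_apply _ r j]
    refine (natDegree_mul_C_le _ _).trans ?_
    rw [natDegree_comp, natDegree_X_add_C, mul_one]
    exact Nat.le_sub_one_of_lt (hdeg _)
  refine hQ (eq_zero_of_natDegree_lt_card_of_eval_eq_zero Q.det
    (f := fun x : Fin ρ × Fin S => ((x.1 * p + x.2 * n : ℕ) : ℚ)) ?_ ?_ ?_)
  · intro x y hxy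
    have := lattice_injOn hpn hS x.2.2 y.2.2 (Nat.cast_injective hxy)
    exact Prod.ext (Fin.ext this.1) (Fin.ext this.2)
  · rintro ⟨r, s⟩
    let x : ℚ := ((r * p + s * n : ℕ) : ℚ)
    have heval : Q.det.eval x = (Matrix.of fun i j => (Q i j).eval x).det :=
      RingHom.map_det (evalRingHom x) Q
    refine heval.trans (Matrix.exists_mulVec_eq_zero_iff.mp
      ⟨fun j => (a ^ (r : ℕ) * m ^ (s : ℕ)) ^ ((e j).1 : ℕ), ?_, ?_⟩)
    · intro h0
      exact pow_ne_zero _ (mul_ne_zero (pow_ne_zero _ ha0) (pow_ne_zero _ hm))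
        (congrFun h0 ⟨0, ht⟩)
    · ext i
      have hi := h (r + i) (by lia) s s.2
      rw [← Finset.sum_subset (Finset.subset_univ {l | P l ≠ 0}) fun l _ hl => by
        rw [not_ne_iff.mp (by simpa using hl : ¬ P l ≠ 0), eval_zero, zero_mul]] at hi
      rw [Finset.sum_subtype (p := fun l => P l ≠ 0) _ (fun l => by simp), ← Equiv.sum_comp e] at hi
      refine Eq.trans ?_ hi
      rw [Matrix.mulVec, dotProduct]
      refine Finset.sum_congr rfl fun j _ => ?_
      simp only [Q, Matrix.of_apply, eval_mul, eval_comp, eval_add, eval_X, eval_C, x]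
      have hx : ((r * p + s * n : ℕ) : ℚ) + i * p = (((r + i : ℕ) * p + s * n : ℕ) : ℚ) := by
        push_cast
        ring
      rw [hx, mul_assoc]
      ring
  · rw [Fintype.card_prod, Fintype.card_fin, Fintype.card_fin]
    calc Q.det.natDegree ≤ t * (K - 1) := hQdeg
      _ < t * K := by gcongr; lia
      _ ≤ K * L := by rw [mul_comm]; gcongr
      _ ≤ ρ * S := hKL

end ZeroEstimate

section InterpolationDeterminant

open Polynomial

/-- The function `λ ↦ (λ choose k) y ^ l` at the lattice point `λ = r p + s n`, `y = a ^ r m ^ s`. -/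
def interpolationEntry (p n a m : ℕ) {K L : ℕ} (x : ℕ × ℕ) (j : Fin K × Fin L) : ℕ :=
  (x.1 * p + x.2 * n).choose j.1 * (a ^ x.1 * m ^ x.2) ^ (j.2 : ℕ)

theorem eq_zero_of_sum_mul_choose_eq_zero {K : ℕ} {c : Fin K → ℚ}
    (h : ∀ x : ℕ, ∑ k, c k * (x.choose k : ℚ) = 0) : c = 0 := by
  suffices H : ∀ i : ℕ, ∀ hi : i < K, c ⟨i, hi⟩ = 0 from funext fun k => H k k.2
  intro i
  induction i using Nat.strong_induction_on with
  | _ i ih =>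
    intro hi
    have hx := h i
    rw [Finset.sum_eq_single ⟨i, hi⟩, Nat.choose_self, Nat.cast_one, mul_one] at hx
    · exact hx
    · intro k _ hk
      rcases lt_or_gt_of_ne (fun h => hk (Fin.ext h) : (k : ℕ) ≠ i) with h | h
      · rw [ih k h k.2, zero_mul]
      · rw [Nat.choose_eq_zero_of_lt h, Nat.cast_zero, mul_zero]
    · exact fun h => absurd (Finset.mem_univ _) h

theorem eval_descPochhammer_mul_inv_factorial (x k : ℕ) :
    ((k.factorial : ℚ)⁻¹) * (descPochhammer ℚ k).eval (x : ℚ) = x.choose k := by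
  rw [descPochhammer_eval_eq_descFactorial, Nat.descFactorial_eq_factorial_mul_choose, Nat.cast_mul,
    inv_mul_cancel_left₀ (Nat.cast_ne_zero.mpr k.factorial_ne_zero)]

theorem exists_interpolation_det_ne_zero {K L ρ S p n a m : ℕ} (ha : 1 < a) (hm : m ≠ 0)
    (hpn : p.Coprime n) (hS : S ≤ p) (hK : 0 < K) (hKL : K * L ≤ ρ * S) :
    ∃ f : Fin K × Fin L → ℕ × ℕ, (∀ i, (f i).1 < ρ + L ∧ (f i).2 < S) ∧
      (Matrix.of fun i j => (interpolationEntry p n a m (f i) j : ℤ)).det ≠ 0 := by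
  let A : Matrix (Fin (ρ + L) × Fin S) (Fin K × Fin L) ℚ :=
    Matrix.of fun x j => (interpolationEntry p n a m (x.1, x.2) j : ℚ)
  have hA : ∀ v, A.mulVec v = 0 → v = 0 := by
    intro v hv
    let P : Fin L → ℚ[X] := fun l =>
      ∑ k : Fin K, C (v (k, l) * ((k : ℕ).factorial : ℚ)⁻¹) * descPochhammer ℚ k
    have heval : ∀ l (x : ℕ), (P l).eval (x : ℚ) = ∑ k : Fin K, v (k, l) * (x.choose k : ℚ) := by
      intro l x
      rw [eval_finsetSum]
      refine Finset.sum_congr rfl fun k _ => ?_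
      rw [eval_mul, eval_C, mul_assoc, eval_descPochhammer_mul_inv_factorial]
    have hP : P = 0 := by
      refine eq_zero_of_sum_eval_mul_pow_eq_zero (a := a) (m := m) (p := p) (n := n) (K := K) (ρ := ρ)
        (S := S) (pow_right_injective₀ (by positivity) (by exact_mod_cast ha.ne'))
        (by positivity) (by positivity) hpn hS hK hKL (fun l => ?_) fun r hr s hs => ?_
      · refine (natDegree_sum_le_of_forall_le (n := K - 1) _ _ fun k _ => ?_).trans_lt
          (Nat.sub_one_lt hK.ne')
        refine (natDegree_C_mul_le _ _).trans ?_
        rw [descPochhammer_natDegree]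
        exact Nat.le_sub_one_of_lt k.2
      · have hx := congrFun hv (⟨r, hr⟩, ⟨s, hs⟩)
        rw [Matrix.mulVec, dotProduct, Fintype.sum_prod_type_right] at hx
        refine Eq.trans (Finset.sum_congr rfl fun l _ => ?_) hx
        rw [heval, Finset.sum_mul]
        refine Finset.sum_congr rfl fun k _ => ?_
        simp only [A, Matrix.of_apply, interpolationEntry]
        push_cast
        ring
    ext ⟨k, l⟩
    have hl : (fun k => v (k, l)) = 0 := eq_zero_of_sum_mul_choose_eq_zero fun x => by
      rw [← heval, hP, Pi.zero_apply, eval_zero]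
    exact congrFun hl k
  obtain ⟨f, hf⟩ := Matrix.exists_submatrix_det_ne_zero hA
  refine ⟨fun i => ((f i).1, (f i).2), fun i => ⟨(f i).1.2, (f i).2.2⟩, fun h0 => hf ?_⟩
  have := congrArg (Int.castRingHom ℚ) h0
  rw [RingHom.map_det, map_zero] at this
  refine Eq.trans (congrArg Matrix.det ?_) this
  ext i j
  simp [A]

end InterpolationDeterminant

section Divisibility

theorem sum_range_choose_mul_pow {b A : ℕ} (h : b < A) (u : ℤ) :
    ∑ j ∈ Finset.range A, (b.choose j : ℤ) * u ^ j = (1 + u) ^ b := by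
  rw [add_comm 1 u, add_pow, ← Finset.sum_subset (Finset.range_mono (Nat.succ_le_of_lt h)) fun j _ hj => by
    rw [Nat.choose_eq_zero_of_lt (by simpa using hj), Nat.cast_zero, zero_mul]]
  exact Finset.sum_congr rfl fun j _ => by rw [one_pow, mul_one, mul_comm]

theorem sum_range_choose_mul_choose_mul_pow {lam A : ℕ} (h : lam < A) (k : ℕ) (u : ℤ) :
    ∑ h ∈ Finset.range A, (lam.choose h : ℤ) * (h.choose k * u ^ (h - k) * (1 + u) ^ k) =
      lam.choose k * (1 + u) ^ lam := by
  rcases lt_or_ge lam k with hk | hk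
  · rw [Nat.choose_eq_zero_of_lt hk, Nat.cast_zero, zero_mul]
    refine Finset.sum_eq_zero fun h _ => ?_
    rcases lt_or_ge lam h with hh | hh
    · rw [Nat.choose_eq_zero_of_lt hh, Nat.cast_zero, zero_mul]
    · rw [Nat.choose_eq_zero_of_lt (hh.trans_lt hk), Nat.cast_zero, zero_mul, zero_mul, mul_zero]
  · obtain ⟨B, rfl⟩ := Nat.exists_eq_add_of_le (hk.trans h.le)
    rw [Finset.sum_range_add, Finset.sum_eq_zero fun h hh => by
      rw [Nat.choose_eq_zero_of_lt (Finset.mem_range.mp hh), Nat.cast_zero, zero_mul, zero_mul,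
        mul_zero], zero_add]
    have hsum := sum_range_choose_mul_pow (b := lam - k) (A := B) (by lia) u
    have hpow : (1 + u) ^ lam = (1 + u) ^ (lam - k) * (1 + u) ^ k := by
      rw [← pow_add, Nat.sub_add_cancel hk]
    rw [hpow, ← hsum, Finset.sum_mul, Finset.mul_sum]
    refine Finset.sum_congr rfl fun j _ => ?_
    rw [Nat.add_sub_cancel_left]
    rcases lt_or_ge lam (k + j) with hj | hj
    · rw [Nat.choose_eq_zero_of_lt hj, Nat.choose_eq_zero_of_lt (by lia : lam - k < j)]
      simp
    · have := Nat.choose_mul (n := lam) (Nat.le_add_right k j)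
      rw [Nat.add_sub_cancel_left] at this
      rw [← mul_assoc, ← mul_assoc, ← Nat.cast_mul, this, Nat.cast_mul]
      ring

theorem pow_dvd_choose_mul_pow_sub_sum (N lam k : ℕ) (d t : ℤ) :
    d ^ N ∣ d ^ k * (lam.choose k * (1 + d * t) ^ lam) - ∑ h ∈ Finset.range N,
      d ^ h * lam.choose h * (h.choose k * t ^ (h - k) * (1 + d * t) ^ k) := by
  have hterm : ∀ h : ℕ, d ^ k * ((lam.choose h : ℤ) *
      (h.choose k * (d * t) ^ (h - k) * (1 + d * t) ^ k)) =
        d ^ h * lam.choose h * (h.choose k * t ^ (h - k) * (1 + d * t) ^ k) := by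
    intro h
    rcases lt_or_ge h k with hk | hk
    · rw [Nat.choose_eq_zero_of_lt hk]
      simp
    · have : d ^ h = d ^ k * d ^ (h - k) := by rw [← pow_add, Nat.add_sub_cancel' hk]
      rw [this, mul_pow]
      ring
  rw [← sum_range_choose_mul_choose_mul_pow (by lia : lam < N + (lam + 1)) k (d * t), Finset.mul_sum,
    Finset.sum_congr rfl fun h _ => hterm h, Finset.sum_range_add, add_sub_cancel_left]
  refine Finset.dvd_sum fun h _ => ?_
  rw [pow_add, mul_assoc, mul_assoc]
  exact dvd_mul_right _ _

theorem pow_dvd_det_choose_mul_pow {K L : ℕ} {d w : ℤ} (hd : d ≠ 0) (hw : d ∣ w - 1)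
    {lam : Fin K × Fin L → ℕ} {y : Fin K × Fin L → ℤ} (hy : ∀ i, d ^ (K * L) ∣ y i - w ^ lam i) :
    d ^ (∑ h ∈ Finset.range (K * L), h) ∣ d ^ (L * ∑ k ∈ Finset.range K, k) *
      (Matrix.of fun i j : Fin K × Fin L =>
        ((lam i).choose (j.1 : ℕ) : ℤ) * y i ^ (j.2 : ℕ)).det := by
  have ht : ∀ l : Fin L, ∃ t : ℤ, w ^ (l : ℕ) = 1 + d * t := fun l => by
    obtain ⟨t, ht⟩ := (hw.trans (by simpa using sub_dvd_pow_sub_pow w 1 (l : ℕ)))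
    exact ⟨t, by rw [← ht]; ring⟩
  choose t ht using ht
  have hdet := Matrix.pow_dvd_det (N := K * L) (by simp) hd
    (M := Matrix.of fun i j : Fin K × Fin L =>
      d ^ (j.1 : ℕ) * Matrix.of (fun i j : Fin K × Fin L =>
        ((lam i).choose (j.1 : ℕ) : ℤ) * y i ^ (j.2 : ℕ)) i j)
    (fun i h => ((lam i).choose h : ℤ))
    (fun h j => h.choose (j.1 : ℕ) * t j.2 ^ (h - j.1) * (1 + d * t j.2) ^ (j.1 : ℕ)) fun i j => by
      have h1 := pow_dvd_choose_mul_pow_sub_sum (K * L) (lam i) j.1 d (t j.2)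
      have h2 : d ^ (K * L) ∣ d ^ (j.1 : ℕ) * ((lam i).choose (j.1 : ℕ) * y i ^ (j.2 : ℕ)) -
          d ^ (j.1 : ℕ) * ((lam i).choose (j.1 : ℕ) * (1 + d * t j.2) ^ lam i) := by
        rw [← mul_sub, ← mul_sub, ← ht, pow_right_comm]
        exact (((hy i).trans (sub_dvd_pow_sub_pow _ _ _)).mul_left _).mul_left _
      simpa using dvd_add h2 h1
  rw [Matrix.det_mul_row, Finset.prod_pow_eq_pow_sum, Fintype.sum_prod_type] at hdet
  convert! hdet using 3
  rw [Finset.mul_sum, Finset.sum_range]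
  simp

end Divisibility

theorem PrimePowerSolution.exists_congr_pow {m p n : ℕ} (h : PrimePowerSolution m p n) :
    ∃ w : ℤ, 8 ∣ w - 1 ∧ 8 ^ n ∣ 9 - w ^ p ∧ 8 ^ n ∣ m - w ^ n := by
  have hunit : ∀ a : ℤ, 8 ∣ a - 1 → ∀ c : ℕ, 8 ^ n ∣ a ^ (8 ^ n * c + 1) - a := fun a ha c => by
    have h1 := dvd_sub_pow_of_dvd_sub (p := 8) (a := a) (b := 1) (by exact_mod_cast ha) n
    rw [one_pow] at h1
    have h2 := ((pow_dvd_pow _ n.le_succ).trans h1).trans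
      (by simpa using sub_dvd_pow_sub_pow (a ^ 8 ^ n) 1 c)
    have h3 : a ^ (8 ^ n * c + 1) - a = ((a ^ 8 ^ n) ^ c - 1) * a := by ring
    rw [h3]
    exact h2.mul_right a
  have hcop : p.Coprime (8 ^ n) :=
    (Nat.Coprime.pow_right 3 h.odd_prime.coprime_two_right : p.Coprime (2 ^ 3)).pow_right n
  have h8 : 1 < 8 ^ n := Nat.one_lt_pow (Nat.ne_of_gt (by have := h.lt; lia)) (by norm_num)
  obtain ⟨b, -, hb⟩ := Nat.exists_mul_mod_eq_one_of_coprime hcop h8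
  have hpb := Nat.div_add_mod (p * b) (8 ^ n)
  rw [hb] at hpb
  refine ⟨9 ^ b, ?_, ?_, ?_⟩
  · simpa using sub_dvd_pow_sub_pow (9 : ℤ) 1 b
  · rw [← pow_mul, mul_comm b, ← hpb, dvd_sub_comm]
    exact hunit 9 (by norm_num) _
  · have hm : (8 : ℤ) ∣ m - 1 := by have := h.mod_eight; lia
    have h9 : (m : ℤ) ^ p + 8 ^ n = 9 ^ n := by exact_mod_cast h.eq
    have h1 : (8 : ℤ) ^ n ∣ (9 ^ n) ^ b - ((m : ℤ) ^ p) ^ b :=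
      Dvd.dvd.trans (by rw [← h9, add_sub_cancel_left]) (sub_dvd_pow_sub_pow _ _ _)
    have h2 := hunit m hm (p * b / 8 ^ n)
    rw [hpb, pow_mul] at h2
    rw [pow_right_comm, dvd_sub_comm]
    simpa using dvd_add h1 h2

/-- The divisibility of the interpolation determinant at points of a solution. -/
theorem PrimePowerSolution.pow_dvd_interpolation_det {m p n K L : ℕ} (h : PrimePowerSolution m p n)
    (hKL : K * L ≤ n) (f : Fin K × Fin L → ℕ × ℕ) :
    (8 : ℤ) ^ (∑ h ∈ Finset.range (K * L), h) ∣ 8 ^ (L * ∑ k ∈ Finset.range K, k) *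
      (Matrix.of fun i j => (interpolationEntry p n 9 m (f i) j : ℤ)).det := by
  obtain ⟨w, hw, hwp, hwn⟩ := h.exists_congr_pow
  have := pow_dvd_det_choose_mul_pow (K := K) (L := L) (by norm_num) hw
    (lam := fun i => (f i).1 * p + (f i).2 * n)
    (y := fun i => (9 : ℤ) ^ (f i).1 * (m : ℤ) ^ (f i).2) fun i => by
      refine (pow_dvd_pow 8 hKL).trans ?_
      have h1 := hwp.trans (sub_dvd_pow_sub_pow (9 : ℤ) (w ^ p) (f i).1)
      have h2 := hwn.trans (sub_dvd_pow_sub_pow (m : ℤ) (w ^ n) (f i).2)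
      have h3 : (9 : ℤ) ^ (f i).1 * (m : ℤ) ^ (f i).2 - w ^ ((f i).1 * p + (f i).2 * n) =
        (9 ^ (f i).1 - (w ^ p) ^ (f i).1) * (m : ℤ) ^ (f i).2 +
          (w ^ p) ^ (f i).1 * ((m : ℤ) ^ (f i).2 - (w ^ n) ^ (f i).2) := by ring
      rw [h3]
      exact dvd_add (h1.mul_right _) (h2.mul_left _)
  convert! this using 6

section Estimates

open Real in
theorem pow_succ_le_pow_mul_sq_factorial {K : ℕ} (hK : 1 ≤ K) :
    ((K + 1 : ℕ) : ℝ) ^ ((K + 1) * K) ≤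
      (K : ℝ) ^ (K * (K - 1)) * (K.factorial : ℝ) ^ 2 * (9 / 2) ^ (2 * K) := by
  have hK0 : (0 : ℝ) < K := by exact_mod_cast hK
  have hK1 : (1 : ℝ) ≤ K := by exact_mod_cast hK
  have he := exp_one_lt_d9
  have he0 := exp_pos 1
  have h1 : ((K + 1 : ℕ) : ℝ) ^ K ≤ K ^ K * exp 1 := by
    have h := add_one_le_exp (1 / K : ℝ)
    have h2 : ((K + 1 : ℕ) : ℝ) = K * (1 / K + 1) := by
      rw [mul_add, mul_one_div_cancel hK0.ne', mul_one, add_comm, Nat.cast_add, Nat.cast_one]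
    rw [h2, mul_pow]
    gcongr
    calc (1 / K + 1 : ℝ) ^ K ≤ exp (1 / K) ^ K := by gcongr
      _ = exp 1 := by rw [← exp_nat_mul, mul_one_div_cancel hK0.ne']
  have h2 : exp 1 * (K / exp 1) ^ (2 * K) ≤ (K.factorial : ℝ) ^ 2 := by
    have h := pow_le_pow_left₀ (by positivity) (Stirling.le_factorial_stirling K) 2
    refine le_trans ?_ h
    rw [mul_pow, sq_sqrt (by positivity), ← pow_mul, mul_comm K 2]
    gcongr
    nlinarith [pi_gt_three]
  have h3 : exp 1 ^ 3 ≤ (9 / 2 : ℝ) ^ 2 := by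
    calc exp 1 ^ 3 ≤ 2.7182818286 ^ 3 := by gcongr
      _ ≤ _ := by norm_num
  have hexp : K * (K - 1) + 2 * K = (K + 1) * K := by
    obtain ⟨k, rfl⟩ := Nat.exists_eq_add_of_le hK
    rw [Nat.add_sub_cancel_left]
    ring
  calc ((K + 1 : ℕ) : ℝ) ^ ((K + 1) * K) = (((K + 1 : ℕ) : ℝ) ^ K) ^ (K + 1) := by
        rw [← pow_mul, mul_comm]
    _ ≤ (K ^ K * exp 1) ^ (K + 1) := by gcongr
    _ = K ^ (K * (K - 1)) * (exp 1 * (K / exp 1) ^ (2 * K)) * (exp 1 ^ 3) ^ K := by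
        rw [mul_pow, ← pow_mul, mul_comm K (K + 1), ← hexp, pow_add, div_pow]
        field_simp
        ring
    _ ≤ K ^ (K * (K - 1)) * (K.factorial : ℝ) ^ 2 * ((9 / 2) ^ 2) ^ K := by gcongr
    _ = _ := by rw [← pow_mul]

theorem pow_le_sq_prod_factorial_mul_pow (K : ℕ) :
    (K : ℝ) ^ (K * (K - 1)) ≤
      (∏ k ∈ Finset.range K, (k.factorial : ℝ)) ^ 2 * (9 / 2) ^ (K * (K - 1)) := by
  induction K with
  | zero => simp
  | succ K ih =>
    rcases Nat.eq_zero_or_pos K with rfl | hK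
    · simp
    · have hexp : K * (K - 1) + 2 * K = (K + 1) * K := by
        obtain ⟨k, rfl⟩ := Nat.exists_eq_add_of_le hK
        rw [Nat.add_sub_cancel_left]
        ring
      rw [Nat.add_sub_cancel, Finset.prod_range_succ, mul_pow]
      refine (pow_succ_le_pow_mul_sq_factorial hK).trans ?_
      rw [← hexp, pow_add (9 / 2 : ℝ)]
      calc _ ≤ (∏ k ∈ Finset.range K, (k.factorial : ℝ)) ^ 2 * (9 / 2) ^ (K * (K - 1)) *
            (K.factorial : ℝ) ^ 2 * (9 / 2) ^ (2 * K) := by gcongr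
        _ = _ := by ring

theorem sq_prod_choose_le {K : ℕ} (hK : 0 < K) (A : ℕ) :
    (∏ k ∈ Finset.range K, (A.choose k : ℝ)) ^ 2 ≤ (9 / 2 * A / K) ^ (K * (K - 1)) := by
  have hG : 0 < ∏ k ∈ Finset.range K, (k.factorial : ℝ) :=
    Finset.prod_pos fun k _ => by exact_mod_cast k.factorial_pos
  have h1 : ∏ k ∈ Finset.range K, (A.choose k : ℝ) ≤
      (A : ℝ) ^ (∑ k ∈ Finset.range K, k) / ∏ k ∈ Finset.range K, (k.factorial : ℝ) := by
    rw [← Finset.prod_pow_eq_pow_sum, ← Finset.prod_div_distrib]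
    exact Finset.prod_le_prod (fun _ _ => by positivity) fun k _ => Nat.choose_le_pow_div k A
  calc _ ≤ ((A : ℝ) ^ (∑ k ∈ Finset.range K, k) / ∏ k ∈ Finset.range K, (k.factorial : ℝ)) ^ 2 := by
        gcongr
    _ = (A : ℝ) ^ (K * (K - 1)) / (∏ k ∈ Finset.range K, (k.factorial : ℝ)) ^ 2 := by
        rw [div_pow, ← pow_mul, Finset.sum_range_id_mul_two]
    _ ≤ _ := by
        rw [div_le_iff₀ (by positivity), div_pow, mul_pow]
        have h2 := pow_le_sq_prod_factorial_mul_pow K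
        have hK0 : (0 : ℝ) < K := by exact_mod_cast hK
        rw [div_mul_eq_mul_div, le_div_iff₀ (by positivity)]
        calc (A : ℝ) ^ (K * (K - 1)) * K ^ (K * (K - 1)) ≤ A ^ (K * (K - 1)) *
              ((∏ k ∈ Finset.range K, (k.factorial : ℝ)) ^ 2 * (9 / 2) ^ (K * (K - 1))) := by gcongr
          _ = _ := by ring

theorem abs_interpolation_det_le {p n a m A Y K L : ℕ} {f : Fin K × Fin L → ℕ × ℕ}
    (hA : ∀ i, (f i).1 * p + (f i).2 * n ≤ A) (hY : ∀ i, a ^ (f i).1 * m ^ (f i).2 ≤ Y) :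
    |(Matrix.of fun i j => (interpolationEntry p n a m (f i) j : ℤ)).det| ≤
      (K * L).factorial * ((∏ k ∈ Finset.range K, (A.choose k : ℤ)) ^ L *
        (Y : ℤ) ^ (K * ∑ l ∈ Finset.range L, l)) := by
  have h := Matrix.abs_det_le_factorial_mul_prod
    (M := Matrix.of fun i j => (interpolationEntry p n a m (f i) j : ℤ))
    (c := fun j => ((A.choose j.1 : ℕ) : ℤ) * (Y : ℤ) ^ (j.2 : ℕ)) fun i j => by
      rw [Matrix.of_apply, Nat.abs_cast]
      exact_mod_cast Nat.mul_le_mul (Nat.choose_le_choose _ (hA i)) (Nat.pow_le_pow_left (hY i) _)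
  rw [Fintype.card_prod, Fintype.card_fin, Fintype.card_fin] at h
  refine h.trans_eq (congrArg _ ?_)
  rw [Finset.prod_mul_distrib, Fintype.prod_prod_type, Fintype.prod_prod_type,
    mul_comm K, pow_mul, ← Finset.prod_pow_eq_pow_sum, Finset.prod_range, Finset.prod_range]
  simp [Finset.prod_pow]

theorem PrimePowerSolution.pow_le_of_interpolation {m p n K L ρ S A Y : ℕ}
    (h : PrimePowerSolution m p n) (hK : 0 < K) (hL : 0 < L) (hKLn : K * L ≤ n) (hS : S ≤ p)
    (hKL : K * L ≤ ρ * S) (hA : ∀ r < ρ + L, ∀ s < S, r * p + s * n ≤ A)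
    (hY : ∀ r < ρ + L, ∀ s < S, 9 ^ r * m ^ s ≤ Y) :
    (8 : ℝ) ^ (K * (L - 1)) ≤ (K * L) ^ 2 * (9 / 2 * A / K) ^ (K - 1) * Y ^ (L - 1) := by
  obtain ⟨f, hf, hne⟩ := exists_interpolation_det_ne_zero (a := 9) (n := n) (by norm_num)
    (by have := h.one_lt; lia : m ≠ 0) h.coprime.coprime_mul_left_right hS hK hKL
  have hdvd := h.pow_dvd_interpolation_det hKLn f
  have hle := abs_interpolation_det_le (fun i => hA _ (hf i).1 _ (hf i).2)
    (fun i => hY _ (hf i).1 _ (hf i).2)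
  have hlow := Int.le_of_dvd (by positivity) ((dvd_abs _ _).mpr hdvd)
  rw [abs_mul, abs_of_nonneg (by positivity : (0 : ℤ) ≤ 8 ^ (L * ∑ k ∈ Finset.range K, k))] at hlow
  have hint := hlow.trans (mul_le_mul_of_nonneg_left hle (by positivity))
  have hreal : (8 : ℝ) ^ (∑ h ∈ Finset.range (K * L), h) ≤ 8 ^ (L * ∑ k ∈ Finset.range K, k) *
      ((K * L).factorial * ((∏ k ∈ Finset.range K, (A.choose k : ℝ)) ^ L *
        (Y : ℝ) ^ (K * ∑ l ∈ Finset.range L, l))) := by exact_mod_cast hint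
  have hsq := pow_le_pow_left₀ (by positivity) hreal 2
  rw [← pow_mul, Finset.sum_range_id_mul_two, mul_pow, ← pow_mul, mul_assoc L (Finset.sum _ _),
    Finset.sum_range_id_mul_two, mul_pow, mul_pow, ← pow_mul, ← pow_mul, mul_assoc K (Finset.sum _ _),
    Finset.sum_range_id_mul_two, mul_comm L 2, pow_mul _ 2 L] at hsq
  have hfac : ((K * L).factorial : ℝ) ≤ ((K * L : ℕ) : ℝ) ^ (K * L) := by
    exact_mod_cast Nat.factorial_le_pow (K * L)
  have hchoose := sq_prod_choose_le hK A
  have hsplit : K * L * (K * L - 1) = L * (K * (K - 1)) + K * (L - 1) * (K * L) := by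
    obtain ⟨k, rfl⟩ := Nat.exists_eq_add_of_le' hK
    obtain ⟨l, rfl⟩ := Nat.exists_eq_add_of_le' hL
    have : (k + 1) * (l + 1) - 1 = k + (k + 1) * l := by
      rw [Nat.sub_eq_iff_eq_add (Nat.mul_pos hK hL)]
      ring
    rw [this, Nat.add_sub_cancel, Nat.add_sub_cancel]
    ring
  rw [hsplit, pow_add] at hsq
  have hcancel := le_of_mul_le_mul_left hsq (by positivity)
  refine le_of_pow_le_pow_left₀ (Nat.mul_pos hK hL).ne' (by positivity) ?_
  rw [← pow_mul]
  calc _ ≤ _ := hcancel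
    _ ≤ (((K * L : ℕ) : ℝ) ^ (K * L)) ^ 2 * (((9 / 2 * A / K) ^ (K * (K - 1))) ^ L *
        Y ^ (K * (L * (L - 1)))) := by gcongr
    _ = _ := by
      generalize (9 / 2 * A / K : ℝ) = B, K - 1 = k, L - 1 = l
      push_cast
      ring

end Estimates

section Parameters

theorem pow_four_le_pow {q : ℕ} (hq : 46 ≤ q) : (q : ℝ) ^ 4 ≤ 1.41 ^ q := by
  induction q, hq using Nat.le_induction with
  | base => norm_num
  | succ q hq ih =>
    have hq' : (46 : ℝ) ≤ q := by exact_mod_cast hq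
    have h1 : ((q + 1 : ℕ) : ℝ) ≤ 47 / 46 * q := by
      push_cast
      linarith
    calc ((q + 1 : ℕ) : ℝ) ^ 4 ≤ (47 / 46 * q) ^ 4 := by gcongr
      _ = (47 / 46) ^ 4 * (q : ℝ) ^ 4 := by rw [mul_pow]
      _ ≤ 1.41 * 1.41 ^ q := by
          gcongr
          norm_num
      _ = _ := (pow_succ' _ _).symm

theorem mul_pow_five_lt_pow {l : ℕ} (hl : 8 ≤ l) :
    1.41 * (1.98 * (25 * (l + 2) ^ 2 + 5 * (l + 2))) ^ 5 * 125.8 ^ l < (32768 : ℝ) ^ l := by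
  induction l, hl using Nat.le_induction with
  | base => norm_num
  | succ l hl ih =>
    have hl' : (8 : ℝ) ≤ l := by exact_mod_cast hl
    calc 1.41 * (1.98 * (25 * ((l + 1 : ℕ) + 2) ^ 2 + 5 * ((l + 1 : ℕ) + 2))) ^ 5 * 125.8 ^ (l + 1)
        ≤ 1.41 * (2 * (1.98 * (25 * ((l : ℝ) + 2) ^ 2 + 5 * (l + 2)))) ^ 5 * 125.8 ^ (l + 1) := by
          have h2 : 25 * (((l + 1 : ℕ) : ℝ) + 2) ^ 2 + 5 * ((l + 1 : ℕ) + 2) ≤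
              2 * (25 * ((l : ℝ) + 2) ^ 2 + 5 * (l + 2)) := by
            push_cast
            nlinarith
          rw [mul_left_comm 2]
          gcongr
      _ = 32 * 125.8 * (1.41 * (1.98 * (25 * ((l : ℝ) + 2) ^ 2 + 5 * (l + 2))) ^ 5 * 125.8 ^ l) := by
          rw [mul_pow 2, pow_succ]
          ring
      _ < 32 * 125.8 * 32768 ^ l := by gcongr
      _ ≤ 32768 ^ l * 32768 := by
          rw [mul_comm]
          gcongr
          norm_num
      _ = _ := (pow_succ _ _).symm

theorem PrimePowerSolution.exponent_lt {m p n : ℕ} (h : PrimePowerSolution m p n) : p < 2100 := by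
  by_contra! hp
  obtain ⟨l, hl, hlp, hpl⟩ : ∃ l : ℕ, 8 ≤ l ∧ 25 * (l + 1) ^ 2 + 5 * (l + 1) ≤ p ∧
      p < 25 * (l + 2) ^ 2 + 5 * (l + 2) := by
    have hle : 8 ≤ p := by lia
    refine ⟨Nat.findGreatest (fun l => 25 * (l + 1) ^ 2 + 5 * (l + 1) ≤ p) p,
      Nat.le_findGreatest hle (by lia),
      Nat.findGreatest_spec (P := fun l => 25 * (l + 1) ^ 2 + 5 * (l + 1) ≤ p) hle (by lia), ?_⟩
    by_contra! hc
    have := Nat.le_findGreatest (P := fun l => 25 * (l + 1) ^ 2 + 5 * (l + 1) ≤ p)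
      (by nlinarith) hc
    lia
  have hp0 : 0 < p := by lia
  have hpn := h.lt
  obtain ⟨q, hq1, hq2⟩ : ∃ q, 5 * (l + 1) * n ≤ p * q ∧ p * q ≤ 5 * (l + 1) * n + (p - 1) := by
    refine ⟨(5 * (l + 1) * n + (p - 1)) / p, ?_, Nat.mul_div_le _ _⟩
    have h1 := Nat.div_add_mod (5 * (l + 1) * n + (p - 1)) p
    have h2 := Nat.mod_lt (5 * (l + 1) * n + (p - 1)) hp0
    lia
  have hlq : 5 * (l + 1) < q := by
    refine Nat.lt_of_mul_lt_mul_left (a := p) ?_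
    nlinarith
  have hKLn : 5 * q * (l + 1) ≤ n := by
    refine Nat.le_of_mul_le_mul_left (c := p) ?_ hp0
    have h1 : p * q ≤ 5 * (l + 1) * n + p := hq2.trans (by lia)
    calc p * (5 * q * (l + 1)) = 5 * (l + 1) * (p * q) := by ring
      _ ≤ 5 * (l + 1) * (5 * (l + 1) * n + n) := by gcongr; lia
      _ = (25 * (l + 1) ^ 2 + 5 * (l + 1)) * n := by ring
      _ ≤ p * n := by gcongr
  have hms : ∀ s ≤ 5 * (l + 1), m ^ s ≤ 9 ^ q := by
    intro s hs
    refine le_of_pow_le_pow_left₀ hp0.ne' (by positivity) ?_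
    calc (m ^ s) ^ p = (m ^ p) ^ s := pow_right_comm _ _ _
      _ ≤ (9 ^ n) ^ s := by
          refine Nat.pow_le_pow_left ?_ s
          rw [← h.eq]
          exact Nat.le_add_right _ _
      _ = 9 ^ (s * n) := by rw [← pow_mul, mul_comm]
      _ ≤ 9 ^ (q * p) := Nat.pow_le_pow_right (by norm_num) (by nlinarith)
      _ = _ := pow_mul _ _ _
  have hmain := h.pow_le_of_interpolation (K := 5 * q) (L := l + 1) (ρ := q) (S := 5 * (l + 1))
    (A := p * (2 * q + (l + 1))) (Y := 9 ^ (2 * q + (l + 1))) (by lia) (by lia) hKLn (by nlinarith)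
    (by nlinarith) (fun r hr s hs => by nlinarith) fun r hr s hs => by
      calc 9 ^ r * m ^ s ≤ 9 ^ (q + (l + 1)) * 9 ^ q :=
            Nat.mul_le_mul (Nat.pow_le_pow_right (by norm_num) hr.le) (hms s hs.le)
        _ = _ := by rw [← pow_add]; congr 1; ring
  rw [Nat.add_sub_cancel] at hmain
  have hq0 : (0 : ℝ) < q := by exact_mod_cast (by lia : 0 < q)
  have hp1 : (2100 : ℝ) ≤ p := by exact_mod_cast hp
  have hlq' : (5 : ℝ) * (l + 1) ≤ q := by exact_mod_cast hlq.le
  have hpl' : (p : ℝ) ≤ 25 * (l + 2) ^ 2 + 5 * (l + 2) := by exact_mod_cast hpl.le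
  have hN : ((5 * q : ℕ) * (l + 1 : ℕ) : ℝ) ^ 2 ≤ (q : ℝ) ^ 4 := by
    calc _ ≤ ((q : ℝ) ^ 2) ^ 2 := by
          gcongr
          push_cast
          nlinarith
      _ = _ := by ring
  have hA : (9 / 2 * (p * (2 * q + (l + 1)) : ℕ) / (5 * q : ℕ) : ℝ) ≤ 1.98 * p := by
    push_cast
    rw [div_le_iff₀ (by positivity)]
    nlinarith
  have hY : ((9 ^ (2 * q + (l + 1)) : ℕ) : ℝ) ≤ 125.8 ^ q := by
    refine le_of_pow_le_pow_left₀ (n := 5) (by norm_num) (by positivity) ?_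
    push_cast
    calc ((9 : ℝ) ^ (2 * q + (l + 1))) ^ 5 = 9 ^ ((2 * q + (l + 1)) * 5) := (pow_mul _ _ _).symm
      _ ≤ 9 ^ (11 * q) := pow_le_pow_right₀ (by norm_num) (by lia)
      _ = (9 ^ 11) ^ q := pow_mul _ _ _
      _ ≤ (125.8 ^ 5) ^ q := by
          gcongr
          norm_num
      _ = _ := pow_right_comm _ _ _
  have hfinal : (((32768 : ℝ) ^ l)) ^ q ≤
      (1.41 * (1.98 * (25 * (l + 2) ^ 2 + 5 * (l + 2))) ^ 5 * 125.8 ^ l) ^ q := by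
    calc ((32768 : ℝ) ^ l) ^ q = 8 ^ (5 * q * l) := by
          rw [show (32768 : ℝ) = 8 ^ 5 by norm_num, ← pow_mul, ← pow_mul]
          congr 1
          ring
      _ ≤ _ := hmain
      _ ≤ (q : ℝ) ^ 4 * (1.98 * p) ^ (5 * q - 1) * (125.8 ^ q) ^ l := by gcongr
      _ ≤ 1.41 ^ q * (1.98 * p) ^ (5 * q) * (125.8 ^ q) ^ l := by
          gcongr
          · exact pow_four_le_pow (by lia)
          · linarith
          · lia
      _ ≤ 1.41 ^ q * (1.98 * (25 * (l + 2) ^ 2 + 5 * (l + 2))) ^ (5 * q) * (125.8 ^ q) ^ l := by gcongr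
      _ = _ := by
          rw [mul_pow _ (125.8 ^ l), mul_pow (1.41 : ℝ), ← pow_mul _ 5, pow_right_comm 125.8]
  exact hfinal.not_gt (pow_lt_pow_left₀ (mul_pow_five_lt_pow hl) (by positivity) (by lia))

end Parameters

section Reductions

theorem sq_add_eight_pow_ne {m n : ℕ} (hn : 2 ≤ n) : m ^ 2 + 8 ^ n ≠ 9 ^ n := by
  intro h
  have h9 : 9 ^ n = (3 ^ n) ^ 2 := by rw [pow_right_comm]; norm_num
  have h8 : 8 ^ n = 2 ^ (3 * n) := by rw [pow_mul]; norm_num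
  have hm : m < 3 ^ n := by
    refine lt_of_pow_lt_pow_left₀ 2 (by positivity) ?_
    rw [← h9, ← h]
    exact Nat.lt_add_of_pos_right (by positivity)
  have hmul : (3 ^ n - m) * (3 ^ n + m) = 2 ^ (3 * n) := by
    rw [mul_comm, ← Nat.sq_sub_sq, ← h9, ← h, Nat.add_sub_cancel_left, h8]
  obtain ⟨a, -, ha⟩ := (Nat.dvd_prime_pow Nat.prime_two).mp (Dvd.intro _ hmul)
  obtain ⟨b, -, hb⟩ := (Nat.dvd_prime_pow Nat.prime_two).mp (Dvd.intro_left _ hmul)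
  have hab : a + b = 3 * n := by
    rw [ha, hb, ← pow_add] at hmul
    exact Nat.pow_right_injective le_rfl hmul
  have hsum : 2 ^ a + 2 ^ b = 2 * 3 ^ n := by
    rw [← ha, ← hb]
    lia
  have hle : 2 ^ a ≤ 2 ^ b := by
    rw [← ha, ← hb]
    lia
  have hle' : a ≤ b := (Nat.pow_le_pow_iff_right (by norm_num)).mp hle
  have hodd : Odd (3 ^ n) := Odd.pow (by decide)
  have hb2 : 2 ≤ b := by lia
  obtain ⟨c, rfl⟩ := Nat.exists_eq_add_of_le hb2
  have ha1 : a = 1 := by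
    rcases a with _ | _ | a
    · rw [pow_add] at hsum
      lia
    · rfl
    · obtain ⟨d, hd⟩ := hodd
      have e1 : 2 ^ (a + 1 + 1) = 4 * 2 ^ a := by ring
      have e2 : 2 ^ (2 + c) = 4 * 2 ^ c := by ring
      rw [hd, e1, e2] at hsum
      lia
  subst ha1
  have h83 : 4 * 3 ^ n < 8 ^ n := by
    obtain ⟨k, rfl⟩ := Nat.exists_eq_add_of_le' hn
    have := Nat.pow_le_pow_left (by norm_num : 3 ≤ 8) k
    rw [pow_add, pow_add]
    have : 0 < 8 ^ k := by positivity
    lia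
  rw [h8, ← hab] at h83
  have e1 : 2 ^ (1 + (2 + c)) = 8 * 2 ^ c := by ring
  have e2 : 2 ^ (2 + c) = 4 * 2 ^ c := by ring
  lia

theorem exists_odd_solution {p n m : ℕ} (hp : 2 ≤ p) (hn : 2 ≤ n) (h : m ^ p + 8 ^ n = 9 ^ n) :
    ∃ n' m', 2 ≤ n' ∧ Odd n' ∧ m' ^ p + 8 ^ n' = 9 ^ n' := by
  induction n using Nat.strong_induction_on generalizing m with
  | _ n ih =>
    rcases n.even_or_odd' with ⟨t, rfl | rfl⟩
    · have hlt : 8 ^ t < 9 ^ t := Nat.pow_lt_pow_left (by norm_num) (by lia)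
      have hmul : (9 ^ t - 8 ^ t) * (9 ^ t + 8 ^ t) = m ^ p := by
        rw [mul_comm, ← Nat.sq_sub_sq, ← pow_mul, ← pow_mul, mul_comm t, ← h, Nat.add_sub_cancel]
      have hcop : (9 ^ t + 8 ^ t).Coprime (9 ^ t - 8 ^ t) := by
        have h1 : (9 ^ t + 8 ^ t).Coprime (2 * 9 ^ t) := by
          refine Nat.Coprime.mul_right ?_ ?_
          · exact Nat.coprime_two_right.mpr
              ((Odd.pow (by decide)).add_even (Even.pow_of_ne_zero (by decide) (by lia)))
          · rw [Nat.coprime_self_add_left]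
            exact Nat.Coprime.pow _ _ (by norm_num)
        have h2 : 2 * 9 ^ t = (9 ^ t + 8 ^ t) + (9 ^ t - 8 ^ t) := by lia
        rwa [h2, Nat.coprime_self_add_right] at h1
      rcases Nat.lt_or_ge t 2 with ht | ht
      · obtain rfl : t = 1 := by lia
        exact absurd (hmul ▸ by norm_num : (m ^ p).Prime) (Nat.Prime.not_prime_pow hp)
      · obtain ⟨d, hd⟩ := exists_eq_pow_of_mul_eq_pow (Nat.isUnit_iff.mpr hcop.symm) hmul
        exact ih t (by lia) ht (by rw [← hd]; lia : d ^ p + 8 ^ t = 9 ^ t)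
    · exact ⟨_, m, hn, odd_two_mul_add_one t, h⟩

theorem pow_add_pow_ne_three_pow {p x m N : ℕ} (hp : p.Prime) (hp3 : 3 ≤ p) (hx : 4 ≤ x)
    (hx3 : ¬ 3 ∣ x) : x ^ p + m ^ p ≠ 3 ^ N := by
  intro h
  have hodd : Odd p := hp.odd_of_ne_two (by lia)
  obtain ⟨a, -, ha⟩ := (Nat.dvd_prime_pow Nat.prime_three).mp
    (h ▸ hodd.nat_add_dvd_pow_add_pow x m)
  have ha0 : a ≠ 0 := by
    rintro rfl
    lia
  have := Fact.mk Nat.prime_three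
  have hval := padicValNat.pow_add_pow (p := 3) (by decide) (ha ▸ dvd_pow_self 3 ha0) hx3 hodd
  rw [h, ha, padicValNat.prime_pow, padicValNat.prime_pow] at hval
  have hp1 : padicValNat 3 p ≤ 1 := by
    have := Fact.mk hp
    rcases eq_or_ne 3 p with rfl | hne
    · rw [padicValNat_self]
    · rw [padicValNat_primes hne]
      exact zero_le_one
  have hle : x ^ p + m ^ p ≤ 3 * (x + m) := by
    rw [h, ha, ← pow_succ']
    exact Nat.pow_le_pow_right (by norm_num) (by lia)
  have hpow : ∀ y, 4 ≤ y → 16 * y ≤ y ^ p := fun y hy =>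
    calc 16 * y ≤ y ^ 2 * y := Nat.mul_le_mul_right y (Nat.pow_le_pow_left hy 2)
      _ = y ^ 3 := by ring
      _ ≤ y ^ p := Nat.pow_le_pow_right (by lia) hp3
  have hxp := hpow x hx
  rcases Nat.lt_or_ge m 4 with hm | hm
  · lia
  · have := hpow m hm
    lia

theorem primePowerSolution_of_odd {m p n : ℕ} (hp : p.Prime) (hn : 2 ≤ n) (hodd : Odd n)
    (h : m ^ p + 8 ^ n = 9 ^ n) : PrimePowerSolution m p n := by
  have hp2 : p ≠ 2 := by
    rintro rfl
    exact sq_add_eight_pow_ne hn h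
  have hpodd := hp.odd_of_ne_two hp2
  have hp3 : p ≠ 3 := by
    rintro rfl
    refine pow_add_pow_ne_three_pow (x := 2 ^ n) (m := m) (N := 2 * n) hp le_rfl ?_ ?_ ?_
    · exact Nat.pow_le_pow_right (n := 2) (by norm_num) hn
    · exact fun hd => by simpa using Nat.prime_three.dvd_of_dvd_pow hd
    · rw [pow_right_comm, add_comm, pow_mul]
      exact h
  have hpn : ¬ p ∣ n := by
    rintro ⟨c, rfl⟩
    refine pow_add_pow_ne_three_pow (x := 8 ^ c) (m := m) (N := 2 * (p * c)) hp
      (by have := hp.two_le; lia) ?_ ?_ ?_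
    · have hc : c ≠ 0 := by
        rintro rfl
        lia
      exact (by norm_num : 4 ≤ 8).trans (Nat.le_self_pow hc 8)
    · exact fun hd => by simpa using Nat.prime_three.dvd_of_dvd_pow hd
    · rw [← pow_mul, mul_comm c, add_comm, pow_mul 3]
      exact h
  have h8 : m % 8 = 1 := by
    have hmod : m ^ p % 8 = 1 := by
      have h1 : 9 ^ n % 8 = 1 := by rw [Nat.pow_mod]; simp
      have h2 : 8 ∣ 8 ^ n := dvd_pow_self 8 (by lia)
      lia
    have hm : Odd m := by
      refine (Nat.odd_pow_iff hp.ne_zero).mp (Nat.odd_iff.mpr ?_)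
      lia
    obtain ⟨c, rfl⟩ := hpodd
    have hsq : m ^ 2 ≡ 1 [MOD 8] := by
      obtain ⟨d, rfl⟩ := hm
      obtain ⟨e, he⟩ := Nat.even_mul_succ_self d
      have hd : (2 * d + 1) ^ 2 = 1 + 8 * e := by linear_combination 4 * he
      rw [hd, Nat.ModEq, Nat.add_mul_mod_self_left]
    have hmm : m ^ (2 * c + 1) ≡ m [MOD 8] := by
      rw [pow_succ, pow_mul]
      simpa using (hsq.pow c).mul_right m
    exact Eq.trans hmm.symm hmod
  have hm1 : m ≠ 1 := by
    rintro rfl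
    have h1 : 8 ^ n < 9 ^ n := Nat.pow_lt_pow_left (by norm_num) (by lia)
    obtain ⟨k, rfl⟩ := Nat.exists_eq_add_of_le' hn
    have := Nat.pow_le_pow_left (by norm_num : 8 ≤ 9) k
    have : 0 < 8 ^ k := by positivity
    rw [one_pow, pow_add, pow_add] at h
    lia
  refine ⟨hp, ?_, ?_, hodd, ?_, h8, by lia, h⟩
  · have := hp.two_le
    have : p ≠ 4 := by
      rintro rfl
      exact absurd hp (by norm_num)
    lia
  · exact Nat.Coprime.mul_right ((Nat.coprime_primes hp Nat.prime_three).mpr hp3)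
      ((Nat.Prime.coprime_iff_not_dvd hp).mpr hpn)
  · refine (Nat.pow_lt_pow_iff_right (by norm_num : 1 < 9)).mp ?_
    calc 9 ^ p ≤ m ^ p := Nat.pow_le_pow_left (by lia) p
      _ < 9 ^ n := by
        rw [← h]
        exact Nat.lt_add_of_pos_right (by positivity)

end Reductions

/-- For every `n ≥ 2`, the number `9 ^ n - 8 ^ n` is not a perfect power. -/
theorem nine_pow_sub_eight_pow_not_perfect_power (n : ℕ) (hn : 2 ≤ n) :
    ¬ ∃ (m k : ℕ), 2 ≤ m ∧ 2 ≤ k ∧ (9 : ℤ) ^ n - 8 ^ n = (m : ℤ) ^ k := by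
  rintro ⟨m, k, -, hk, h⟩
  have hnat : m ^ k + 8 ^ n = 9 ^ n := by
    zify
    rw [← h, sub_add_cancel]
  obtain ⟨p, hp, c, rfl⟩ := Nat.exists_prime_and_dvd (by lia : k ≠ 1)
  rw [mul_comm, pow_mul] at hnat
  obtain ⟨n', m', hn', hodd, h'⟩ := exists_odd_solution hp.two_le hn hnat
  have hsol := primePowerSolution_of_odd hp hn' hodd h'
  exact hsol.exponent_ge.not_gt hsol.exponent_lt
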